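/- arXiv:2503.06851 — 2 statements merged into one kernel-verified Lean document; each statement's English description precedes it below -/
import Mathlib

section
/- Let T : ℝ^d × 𝒳 → 𝒳 be a continuous action of ℝ^d on a compact metric space (𝒳, 𝐝). The rate distortion function R(𝐝, μ, ε) is upper semicontinuous in (μ, ε): if ε_n → ε in (0,∞) and μ_n → μ in M^T(𝒳) with respect to the weak* topology, then limsup_{n→∞} R(𝐝, μ_n, ε_n) ≤ R(𝐝, μ, ε). -/
open MeasureTheory Filter Set
open scoped ENNReal Topology NNReal

noncomputable section

/-- Shannon entropy (base 2) of a finitely-valued random variable. -/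
def shannonEntropy {Ω S : Type*} [MeasurableSpace Ω] [Fintype S]
    (P : Measure Ω) (f : Ω → S) : ℝ :=
  -∑ i : S, ((P (f ⁻¹' {i})).toReal * Real.logb 2 ((P (f ⁻¹' {i})).toReal))

/-- Mutual information (base 2) of two random variables, defined as the supremum over all
finite measurable partitions (encoded as measurable maps into `Fin n`) of
`H(α∘X) + H(β∘Y) - H(α∘X, β∘Y)`. -/
def mutualInfo {Ω A B : Type*} [MeasurableSpace Ω] [MeasurableSpace A] [MeasurableSpace B]
    (P : Measure Ω) (X : Ω → A) (Y : Ω → B) : ℝ≥0∞ :=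
  ⨆ (n : ℕ) (m : ℕ) (α : A → Fin n) (_ : Measurable α) (β : B → Fin m) (_ : Measurable β),
    ENNReal.ofReal (shannonEntropy P (fun ω => α (X ω)) + shannonEntropy P (fun ω => β (Y ω))
      - shannonEntropy P (fun ω => (α (X ω), β (Y ω))))

/-- The box `[0,L)^d ⊆ ℝ^d`. -/
def unitBox (d : ℕ) (L : ℝ) : Set (Fin d → ℝ) := Set.univ.pi fun _ => Set.Ico (0 : ℝ) L

/-- Lebesgue measure on `ℝ^d` restricted to the box `[0,L)^d`. -/
def boxMeasure (d : ℕ) (L : ℝ) : Measure (Fin d → ℝ) := volume.restrict (unitBox d L)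

/-- The space `L¹([0,L)^d, X)` of measurable maps modulo a.e. equality. -/
abbrev L1Maps (d : ℕ) (L : ℝ) (X : Type*) [TopologicalSpace X] :=
  (Fin d → ℝ) →ₘ[boxMeasure d L] X

/-- The `L¹` distance `D(f,g) = ∫_{[0,L)^d} 𝐝(f(u), g(u)) dm(u)`. -/
def L1dist {d : ℕ} {L : ℝ} {X : Type*} [MetricSpace X] (f g : L1Maps d L X) : ℝ :=
  ∫ u, dist (f u) (g u) ∂(boxMeasure d L)

/-- The Borel σ-algebra of the metric `L1dist` on `L¹([0,L)^d, X)`,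
generated by the open balls of the metric. -/
instance L1Maps.measurableSpace {d : ℕ} {L : ℝ} {X : Type*} [MetricSpace X] :
    MeasurableSpace (L1Maps d L X) :=
  MeasurableSpace.generateFrom {s | ∃ (f : L1Maps d L X) (r : ℝ), s = {g | L1dist f g < r}}

/-- The expected mean distortion `E[(1/L^d) ∫_{[0,L)^d} 𝐝(T^u X, Y_u) dm(u)]`. -/
def distortion {X : Type*} [MetricSpace X] (d : ℕ) (T : (Fin d → ℝ) → X → X) (L : ℝ)
    {Ω : Type*} [MeasurableSpace Ω] (P : Measure Ω) (Xv : Ω → X) (Yv : Ω → L1Maps d L X) : ℝ :=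
  ∫ ω, (L ^ d)⁻¹ * ∫ u, dist (T u (Xv ω)) (Yv ω u) ∂(boxMeasure d L) ∂P

/-- `R_L(𝐝, μ, ε)`: the infimum of `I(X;Y)` over all pairs of random variables on a common
probability space with `Law X = μ`, `Y` taking values in `L¹([0,L)^d, X)` and expected mean
distortion `< ε`. -/
def RL {X : Type*} [MetricSpace X] [MeasurableSpace X] (d : ℕ)
    (T : (Fin d → ℝ) → X → X) (μ : Measure X) (L ε : ℝ) : ℝ≥0∞ :=
  ⨅ (Ω : Type) (_ : MeasurableSpace Ω) (P : Measure Ω) (_ : IsProbabilityMeasure P)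
    (Xv : Ω → X) (Yv : Ω → L1Maps d L X) (_ : Measurable Xv) (_ : Measurable Yv)
    (_ : Measure.map Xv P = μ) (_ : distortion d T L P Xv Yv < ε),
    mutualInfo P Xv Yv

/-- The rate distortion function `R(𝐝, μ, ε) = lim_{L→∞} R_L(𝐝, μ, ε)/L^d`, which exists and
equals `inf_{L>0} R_L(𝐝, μ, ε)/L^d`. -/
def RD {X : Type*} [MetricSpace X] [MeasurableSpace X] (d : ℕ)
    (T : (Fin d → ℝ) → X → X) (μ : Measure X) (ε : ℝ) : ℝ≥0∞ :=
  ⨅ (L : ℝ) (_ : 0 < L), RL d T μ L ε / ENNReal.ofReal (L ^ d)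

/-- Upper rate distortion dimension. -/
def urdim {X : Type*} [MetricSpace X] [MeasurableSpace X] (d : ℕ)
    (T : (Fin d → ℝ) → X → X) (μ : Measure X) : ℝ≥0∞ :=
  Filter.limsup (fun ε : ℝ => RD d T μ ε / ENNReal.ofReal (Real.logb 2 (1 / ε))) (𝓝[>] (0 : ℝ))

/-- Lower rate distortion dimension. -/
def lrdim {X : Type*} [MetricSpace X] [MeasurableSpace X] (d : ℕ)
    (T : (Fin d → ℝ) → X → X) (μ : Measure X) : ℝ≥0∞ :=
  Filter.liminf (fun ε : ℝ => RD d T μ ε / ENNReal.ofReal (Real.logb 2 (1 / ε))) (𝓝[>] (0 : ℝ))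

/-- `μ` is invariant under the `ℝ^d`-action `T`. -/
def MeasInvariant {X : Type*} [MeasurableSpace X] (d : ℕ)
    (T : (Fin d → ℝ) → X → X) (μ : Measure X) : Prop :=
  ∀ u : Fin d → ℝ, Measure.map (T u) μ = μ

/-- `T` is a continuous action of the additive group `ℝ^d`. -/
def IsContAction {X : Type*} [TopologicalSpace X] (d : ℕ) (T : (Fin d → ℝ) → X → X) : Prop :=
  Continuous (fun p : (Fin d → ℝ) × X => T p.1 p.2) ∧ (∀ x, T 0 x = x) ∧
    ∀ u v x, T (u + v) x = T u (T v x)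

/-- The metric `𝐝_L(x,y) = sup_{u ∈ [0,L)^d} 𝐝(T^u x, T^u y)`. -/
def dSup {X : Type*} [MetricSpace X] (d : ℕ) (T : (Fin d → ℝ) → X → X) (L : ℝ) (x y : X) : ℝ :=
  ⨆ u : unitBox d L, dist (T u.1 x) (T u.1 y)

/-- The `ε`-covering number of `X` for the (pre)metric `ρ`: the minimal number of open sets
of `ρ`-diameter `< ε` covering `X`. -/
def covNum (X : Type*) [TopologicalSpace X] (ρ : X → X → ℝ) (ε : ℝ) : ℕ :=
  sInf {n : ℕ | ∃ F : Finset (Set X), F.card = n ∧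
    (∀ U ∈ F, IsOpen U ∧ (⨆ x ∈ U, ⨆ y ∈ U, ENNReal.ofReal (ρ x y)) < ENNReal.ofReal ε) ∧
    ⋃₀ (F : Set (Set X)) = Set.univ}

/-- The entropy at scale `ε`: `S(X,T,𝐝,ε) = lim_{L→∞} log₂ #(X, 𝐝_L, ε) / L^d`
(the limit exists, hence equals the limsup used here). -/
def entScale {X : Type*} [MetricSpace X] (d : ℕ) (T : (Fin d → ℝ) → X → X) (ε : ℝ) : ℝ≥0∞ :=
  Filter.limsup
    (fun L : ℝ => ENNReal.ofReal (Real.logb 2 (covNum X (dSup d T L) ε) / L ^ d)) Filter.atTop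

/-- The upper metric mean dimension. -/
def umdim {X : Type*} [MetricSpace X] (d : ℕ) (T : (Fin d → ℝ) → X → X) : ℝ≥0∞ :=
  Filter.limsup (fun ε : ℝ => entScale d T ε / ENNReal.ofReal (Real.logb 2 (1 / ε))) (𝓝[>] (0 : ℝ))

/-- The σ-algebra on the space of Borel probability measures on `X` (for a compact metric `X`
this is the Borel σ-algebra of the weak* topology). -/
instance ProbabilityMeasure.measurableSpace' {α : Type*} [MeasurableSpace α] :
    MeasurableSpace (ProbabilityMeasure α) :=
  inferInstanceAs (MeasurableSpace {μ : Measure α // IsProbabilityMeasure μ})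

/-- The space `M^T(X)` of `T`-invariant Borel probability measures on `X`. -/
abbrev InvM (X : Type*) [MeasurableSpace X] [MetricSpace X] (d : ℕ)
    (T : (Fin d → ℝ) → X → X) :=
  {ν : ProbabilityMeasure X // MeasInvariant d T (ν : Measure X)}

end


theorem logsum_ineq {ι : Type*} (s : Finset ι) (x y : ι → ℝ) (hx : ∀ j ∈ s, 0 ≤ x j)
    (hy : ∀ j ∈ s, 0 ≤ y j) (hxy : ∀ j ∈ s, y j = 0 → x j = 0) :
    (∑ j ∈ s, x j) * (Real.log (∑ j ∈ s, x j) - Real.log (∑ j ∈ s, y j))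
      ≤ ∑ j ∈ s, x j * (Real.log (x j) - Real.log (y j)) := by
  set X := ∑ j ∈ s, x j with hX
  set Y := ∑ j ∈ s, y j with hY
  rcases (Finset.sum_nonneg hx).eq_or_lt with h0 | hXpos
  · rw [← hX] at h0
    rw [← h0, zero_mul]
    refine Finset.sum_nonneg fun j hj => ?_
    have : x j = 0 := (Finset.sum_eq_zero_iff_of_nonneg hx).1 (hX.symm.trans h0.symm) j hj
    simp [this]
  rw [← hX] at hXpos
  have hYpos : 0 < Y := by
    rcases (Finset.sum_nonneg hy).eq_or_lt with h0 | h
    · exfalso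
      have : X = 0 := Finset.sum_eq_zero fun j hj =>
        hxy j hj ((Finset.sum_eq_zero_iff_of_nonneg hy).1 h0.symm j hj)
      exact hXpos.ne' this
    · exact h
  have key : ∀ j ∈ s, x j * (Real.log X - Real.log Y) + (x j - y j * (X / Y))
      ≤ x j * (Real.log (x j) - Real.log (y j)) := by
    intro j hj
    rcases (hx j hj).eq_or_lt with h0 | hxp
    · rw [← h0]
      have : 0 ≤ y j * (X / Y) := mul_nonneg (hy j hj) (by positivity)
      simp only [zero_mul, zero_sub, zero_add]; linarith
    have hyp : 0 < y j := lt_of_le_of_ne (hy j hj) fun h => hxp.ne' (hxy j hj h.symm)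
    have h1 := Real.log_le_sub_one_of_pos (x := y j * X / (x j * Y)) (by positivity)
    rw [Real.log_div (by positivity) (by positivity), Real.log_mul hyp.ne' hXpos.ne',
      Real.log_mul hxp.ne' hYpos.ne'] at h1
    have h2 := mul_le_mul_of_nonneg_left h1 hxp.le
    have h3 : x j * (y j * X / (x j * Y) - 1) = y j * (X / Y) - x j := by
      field_simp
    rw [h3] at h2
    nlinarith
  calc X * (Real.log X - Real.log Y)
      = ∑ j ∈ s, (x j * (Real.log X - Real.log Y) + (x j - y j * (X / Y))) := by
        rw [Finset.sum_add_distrib, Finset.sum_sub_distrib, ← Finset.sum_mul, ← Finset.sum_mul,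
          ← hX, ← hY]
        field_simp; ring
    _ ≤ _ := Finset.sum_le_sum key

theorem mi_formula {A B : Type*} [Fintype A] [Fintype B] (r : A → B → ℝ) :
    ∑ a, Real.negMulLog (∑ b, r a b) + ∑ b, Real.negMulLog (∑ a, r a b)
      - ∑ ab : A × B, Real.negMulLog (r ab.1 ab.2)
    = ∑ a, ∑ b, r a b * (Real.log (r a b) - Real.log (∑ b, r a b) - Real.log (∑ a, r a b)) := by
  simp only [Real.negMulLog, mul_sub, Finset.sum_sub_distrib, Fintype.sum_prod_type]
  rw [Finset.sum_comm (f := fun a b => r a b * Real.log (∑ a, r a b))]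
  simp only [← Finset.sum_mul, neg_mul, Finset.sum_neg_distrib]
  ring

theorem finite_dpi {A I K B : Type*} [Fintype A] [Fintype I] [Fintype K] [Fintype B]
    [DecidableEq B]
    (w : A → I → ℝ) (hw : ∀ a i, 0 ≤ w a i) (κ : I → K → ℝ) (hκ : ∀ i k, 0 ≤ κ i k)
    (hκ1 : ∀ i, ∑ k, κ i k = 1) (f : K → B) (p : I → ℝ) (hp : ∀ i, ∑ a, w a i = p i)
    (r : A → B → ℝ)
    (hr : ∀ a b, r a b = ∑ j ∈ (Finset.univ : Finset (I × K)).filter (fun j => f j.2 = b),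
      w a j.1 * κ j.1 j.2) :
    ∑ a, Real.negMulLog (∑ b, r a b) + ∑ b, Real.negMulLog (∑ a, r a b)
      - ∑ ab : A × B, Real.negMulLog (r ab.1 ab.2)
    ≤ ∑ i, Real.negMulLog (p i) + ∑ k, Real.negMulLog (∑ i, p i * κ i k)
      - ∑ ik : I × K, Real.negMulLog (p ik.1 * κ ik.1 ik.2) := by
  have hp0 : ∀ i, 0 ≤ p i := fun i => hp i ▸ Finset.sum_nonneg fun a _ => hw a i
  set q : K → ℝ := fun k => ∑ i, p i * κ i k with hq
  have hq0 : ∀ k, 0 ≤ q k := fun k => Finset.sum_nonneg fun i _ => mul_nonneg (hp0 i) (hκ i k)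
  have hrA : ∀ a, ∑ b, r a b = ∑ i, w a i := by
    intro a
    simp only [hr]
    rw [Finset.sum_fiberwise, Fintype.sum_prod_type]
    simp [← Finset.mul_sum, hκ1]
  have hrB : ∀ b, ∑ a, r a b = ∑ k ∈ Finset.univ.filter (fun k => f k = b), q k := by
    intro b
    simp only [hr, hq]
    rw [Finset.sum_comm]
    simp only [← Finset.sum_mul, hp]
    rw [Finset.sum_filter, Fintype.sum_prod_type, Finset.sum_comm, Finset.sum_filter]
    refine Finset.sum_congr rfl fun k _ => ?_
    split_ifs <;> simp
  have hR := mi_formula (fun i k => p i * κ i k)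
  have hpm : ∀ i, ∑ k, p i * κ i k = p i := fun i => by rw [← Finset.mul_sum, hκ1, mul_one]
  simp only [hpm] at hR
  rw [hR, mi_formula]
  have hterm : ∀ i k, p i * κ i k * (Real.log (p i * κ i k) - Real.log (p i) - Real.log (q k))
      = ∑ a, w a i * κ i k * (Real.log (κ i k) - Real.log (q k)) := by
    intro i k
    rw [← Finset.sum_mul, ← Finset.sum_mul, hp]
    by_cases h1 : p i = 0
    · simp [h1]
    by_cases h2 : κ i k = 0
    · simp [h2]
    rw [Real.log_mul h1 h2]; ring
  calc _ ≤ ∑ a, ∑ b, ∑ j ∈ (Finset.univ : Finset (I × K)).filter (fun j => f j.2 = b),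
        w a j.1 * κ j.1 j.2 * (Real.log (κ j.1 j.2) - Real.log (q j.2)) := by
        refine Finset.sum_le_sum fun a _ => Finset.sum_le_sum fun b _ => ?_
        have hls := logsum_ineq ((Finset.univ : Finset (I × K)).filter (fun j => f j.2 = b))
          (fun j => w a j.1 * κ j.1 j.2) (fun j => w a j.1 * q j.2)
          (fun j _ => mul_nonneg (hw _ _) (hκ _ _)) (fun j _ => mul_nonneg (hw _ _) (hq0 _)) (by
            intro j _ h
            rcases mul_eq_zero.1 h with h | h
            · simp [h]
            · have h3 := (Finset.sum_eq_zero_iff_of_nonneg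
                (fun i _ => mul_nonneg (hp0 i) (hκ i j.2))).1 h j.1 (Finset.mem_univ _)
              rcases mul_eq_zero.1 h3 with h4 | h4
              · have := (Finset.sum_eq_zero_iff_of_nonneg
                  (fun a _ => hw a j.1)).1 ((hp j.1).trans h4) a (Finset.mem_univ _)
                simp [this]
              · simp [h4])
        rw [← hr] at hls
        have hY : ∑ j ∈ (Finset.univ : Finset (I × K)).filter (fun j => f j.2 = b),
            w a j.1 * q j.2 = (∑ b, r a b) * (∑ a, r a b) := by
          rw [hrA, hrB, Finset.sum_filter, Fintype.sum_prod_type, Finset.sum_mul]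
          refine Finset.sum_congr rfl fun i _ => ?_
          rw [Finset.mul_sum, Finset.sum_filter]
        rw [hY] at hls
        have hr0 : ∀ a b, 0 ≤ r a b := fun a b => by
          rw [hr]; exact Finset.sum_nonneg fun j _ => mul_nonneg (hw _ _) (hκ _ _)
        refine le_trans (le_of_eq ?_) (hls.trans (le_of_eq ?_))
        · by_cases h1 : ∑ b, r a b = 0
          · have := (Finset.sum_eq_zero_iff_of_nonneg
                  (fun b _ => hr0 a b)).1 h1 b (Finset.mem_univ _)
            simp [this]
          by_cases h2 : ∑ a, r a b = 0
          · have := (Finset.sum_eq_zero_iff_of_nonneg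
                  (fun a _ => hr0 a b)).1 h2 a (Finset.mem_univ _)
            simp [this]
          rw [Real.log_mul h1 h2]; ring
        · refine Finset.sum_congr rfl fun j hj => ?_
          by_cases h1 : w a j.1 = 0
          · simp [h1]
          by_cases h2 : κ j.1 j.2 = 0
          · simp [h2]
          have h3 : q j.2 ≠ 0 := by
            intro h
            have h3 := (Finset.sum_eq_zero_iff_of_nonneg
                (fun i _ => mul_nonneg (hp0 i) (hκ i j.2))).1 h j.1 (Finset.mem_univ _)
            rcases mul_eq_zero.1 h3 with h4 | h4
            · exact h1 ((Finset.sum_eq_zero_iff_of_nonneg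
                  (fun a _ => hw a j.1)).1 ((hp j.1).trans h4) a (Finset.mem_univ _))
            · exact h2 h4
          rw [Real.log_mul h1 h2, Real.log_mul h1 h3]; ring
    _ = ∑ i, ∑ k, ∑ a, w a i * κ i k * (Real.log (κ i k) - Real.log (q k)) := by
        simp only [Finset.sum_fiberwise]
        rw [Finset.sum_comm, Fintype.sum_prod_type]
    _ = _ := by
        refine Finset.sum_congr rfl fun i _ => Finset.sum_congr rfl fun k _ => (hterm i k).symm

theorem shannonEntropy_eq {Ω S : Type*} [MeasurableSpace Ω] [Fintype S]
    (P : Measure Ω) (f : Ω → S) :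
    shannonEntropy P f = (∑ i, Real.negMulLog (P.real (f ⁻¹' {i}))) / Real.log 2 := by
  rw [shannonEntropy, Finset.sum_div, ← Finset.sum_neg_distrib]
  refine Finset.sum_congr rfl fun i _ => ?_
  simp only [Real.negMulLog, Real.logb, Measure.real]
  ring

theorem marg_sum {Ω A B : Type*} [MeasurableSpace Ω] [Fintype B] [MeasurableSpace A]
    [MeasurableSingletonClass A] [MeasurableSpace B] [MeasurableSingletonClass B]
    (P : Measure Ω) [IsFiniteMeasure P] (f : Ω → A) (g : Ω → B)
    (_hf : Measurable f) (hg : Measurable g) (a : A) :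
    ∑ b, P.real (f ⁻¹' {a} ∩ g ⁻¹' {b}) = P.real (f ⁻¹' {a}) := by
  have h := sum_measure_preimage_singleton (μ := P.restrict (f ⁻¹' {a})) (f := g) Finset.univ
    (fun y _ => hg (measurableSet_singleton y))
  have h2 : ∀ b, (P.restrict (f ⁻¹' {a})) (g ⁻¹' {b}) = P (f ⁻¹' {a} ∩ g ⁻¹' {b}) := fun b => by
    rw [Measure.restrict_apply (hg (measurableSet_singleton b)), inter_comm]
  simp only [h2] at h
  simp only [Measure.real]
  rw [← ENNReal.toReal_sum (fun b _ => measure_ne_top _ _), h]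
  simp

/-- The joint law built from a measure, a finite partition and a finite stochastic matrix. -/
noncomputable def Qm {X : Type*} [MeasurableSpace X] {N M : ℕ} (ν : Measure X) (π : X → Fin N)
    (κ : Fin N → Fin M → ℝ) : Measure (X × Fin M) :=
  ∑ j : Fin N × Fin M, ENNReal.ofReal (κ j.1 j.2) •
    (ν.restrict (π ⁻¹' {j.1})).map (fun x => (x, j.2))

section Q
variable {X : Type*} [MeasurableSpace X] {N M : ℕ} (ν : Measure X)
    (π : X → Fin N)

theorem Qm_apply (κ : Fin N → Fin M → ℝ) {S : Set (X × Fin M)} (hS : MeasurableSet S) :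
    Qm ν π κ S = ∑ j : Fin N × Fin M, ENNReal.ofReal (κ j.1 j.2) *
      ν ({x | (x, j.2) ∈ S} ∩ π ⁻¹' {j.1}) := by
  rw [Qm, Measure.finsetSum_apply]
  refine Finset.sum_congr rfl fun j _ => ?_
  have hm : Measurable (fun x : X => (x, j.2)) := by fun_prop
  rw [Measure.smul_apply, Measure.map_apply hm hS, Measure.restrict_apply (hm hS), smul_eq_mul]
  rfl

theorem Qm_fst (hπ : Measurable π) (κ : Fin N → Fin M → ℝ)
    (hκ : ∀ i k, 0 ≤ κ i k) (hκ1 : ∀ i, ∑ k, κ i k = 1) : (Qm ν π κ).map Prod.fst = ν := by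
  ext A hA
  rw [Measure.map_apply measurable_fst hA, Qm_apply ν π κ (measurable_fst hA),
    Fintype.sum_prod_type]
  have h1 : ∀ i, ∑ k, ENNReal.ofReal (κ i k) *
      ν ({x | (x, k) ∈ (Prod.fst ⁻¹' A : Set (X × Fin M))} ∩ π ⁻¹' {i}) = ν.restrict A (π ⁻¹' {i}) := by
    intro i
    rw [Measure.restrict_apply (hπ (measurableSet_singleton i)), inter_comm]
    change ∑ k, ENNReal.ofReal (κ i k) * ν (A ∩ π ⁻¹' {i}) = _
    rw [← Finset.sum_mul, ← ENNReal.ofReal_sum_of_nonneg (fun k _ => hκ i k), hκ1]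
    simp
  simp only [h1]
  rw [sum_measure_preimage_singleton _ (fun y _ => hπ (measurableSet_singleton y))]
  simp

theorem Qm_prob (hπ : Measurable π) (κ : Fin N → Fin M → ℝ)
    (hκ : ∀ i k, 0 ≤ κ i k) (hκ1 : ∀ i, ∑ k, κ i k = 1) [IsProbabilityMeasure ν] : IsProbabilityMeasure (Qm ν π κ) := by
  constructor
  have h := congrArg (fun m : Measure X => m univ) (Qm_fst ν π hπ κ hκ hκ1)
  simp only [Measure.map_apply measurable_fst MeasurableSet.univ, preimage_univ] at h
  rw [h, measure_univ]

theorem Qm_real (κ : Fin N → Fin M → ℝ) (hκ : ∀ i k, 0 ≤ κ i k)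
     [IsFiniteMeasure ν] {S : Set (X × Fin M)} (hS : MeasurableSet S) :
    (Qm ν π κ).real S = ∑ j : Fin N × Fin M, κ j.1 j.2 *
      ν.real ({x | (x, j.2) ∈ S} ∩ π ⁻¹' {j.1}) := by
  rw [Measure.real, Qm_apply ν π κ hS, ENNReal.toReal_sum]
  · refine Finset.sum_congr rfl fun j _ => ?_
    rw [ENNReal.toReal_mul, ENNReal.toReal_ofReal (hκ _ _)]; rfl
  · intro j _
    exact ENNReal.mul_ne_top ENNReal.ofReal_ne_top (measure_ne_top _ _)

theorem Qm_integral_le (hπ : Measurable π) (κ : Fin N → Fin M → ℝ)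
    (hκ : ∀ i k, 0 ≤ κ i k) [IsFiniteMeasure ν] (F : X → Fin M → ℝ) (hF : ∀ k, Measurable fun x => F x k)
    (G : Fin N → Fin M → ℝ) (C : ℝ) (hC : ∀ x k, |F x k| ≤ C)
    (hFG : ∀ x k, F x k ≤ G (π x) k) :
    ∫ z, F z.1 z.2 ∂(Qm ν π κ) ≤ ∑ j : Fin N × Fin M, κ j.1 j.2 * (ν.real (π ⁻¹' {j.1}) * G j.1 j.2) := by
  have hFm : Measurable (fun z : X × Fin M => F z.1 z.2) :=
    measurable_from_prod_countable_left (f := fun z : X × Fin M => F z.1 z.2) hF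
  have hint : ∀ (m : Measure (X × Fin M)) [IsFiniteMeasure m], Integrable (fun z => F z.1 z.2) m :=
    fun m _ => Integrable.of_bound hFm.aestronglyMeasurable C (Eventually.of_forall fun z => hC _ _)
  rw [Qm, integral_finsetSum_measure]
  · refine Finset.sum_le_sum fun j _ => ?_
    rw [integral_smul_measure, ENNReal.toReal_ofReal (hκ _ _), smul_eq_mul,
      integral_map (by fun_prop) hFm.aestronglyMeasurable]
    refine mul_le_mul_of_nonneg_left ?_ (hκ _ _)
    have hm := hπ (measurableSet_singleton j.1)
    have : ∫ x in π ⁻¹' {j.1}, F x j.2 ∂ν ≤ ∫ x in π ⁻¹' {j.1}, G j.1 j.2 ∂ν := by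
      refine setIntegral_mono_on ?_ (by simp) hm ?_
      · exact Integrable.of_bound (hF _).aestronglyMeasurable C
          (Eventually.of_forall fun z => hC _ _)
      · intro x hx
        have : π x = j.1 := hx
        exact this ▸ hFG x j.2
    refine this.trans (le_of_eq ?_)
    simp
  · intro j _
    exact (hint _).smul_measure ENNReal.ofReal_ne_top

/-- The mutual information of a finite channel. -/
noncomputable def Jfun (κ : Fin N → Fin M → ℝ) (p : Fin N → ℝ) : ℝ :=
  (∑ i, Real.negMulLog (p i) + ∑ k, Real.negMulLog (∑ i, p i * κ i k)
      - ∑ ik : Fin N × Fin M, Real.negMulLog (p ik.1 * κ ik.1 ik.2)) / Real.log 2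

theorem Jfun_cont (κ : Fin N → Fin M → ℝ) : Continuous (Jfun κ) := by
  unfold Jfun
  have := Real.continuous_negMulLog
  fun_prop

theorem Qm_mutualInfo (hπ : Measurable π) (κ : Fin N → Fin M → ℝ)
    (hκ : ∀ i k, 0 ≤ κ i k) (hκ1 : ∀ i, ∑ k, κ i k = 1) [IsProbabilityMeasure ν] {B : Type*} [MeasurableSpace B] (c : Fin M → B) :
    mutualInfo (Qm ν π κ) Prod.fst (fun z => c z.2)
      ≤ ENNReal.ofReal (Jfun κ (fun i => ν.real (π ⁻¹' {i}))) := by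
  classical
  have := Qm_prob ν π hπ κ hκ hκ1
  unfold mutualInfo
  refine iSup_le fun n => iSup_le fun m => iSup_le fun α => iSup_le fun hα => iSup_le fun β =>
    iSup_le fun hβ => ENNReal.ofReal_le_ofReal ?_
  rw [shannonEntropy_eq, shannonEntropy_eq, shannonEntropy_eq, ← add_div, ← sub_div, Jfun]
  refine div_le_div_of_nonneg_right ?_ (Real.log_nonneg (by norm_num))
  have hα' : Measurable (fun z : X × Fin M => α z.1) := hα.comp measurable_fst
  have hβ' : Measurable (fun z : X × Fin M => β (c z.2)) :=
    (Measurable.of_discrete (f := fun k => β (c k))).comp measurable_snd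
  have key := finite_dpi (fun (a : Fin n) (i : Fin N) => ν.real (π ⁻¹' {i} ∩ α ⁻¹' {a}))
    (fun _ _ => measureReal_nonneg) κ hκ hκ1 (fun k => β (c k)) (fun i => ν.real (π ⁻¹' {i}))
    (fun i => marg_sum ν π α hπ hα i)
    (fun a b => (Qm ν π κ).real ((fun z : X × Fin M => α z.1) ⁻¹' {a} ∩
      (fun z : X × Fin M => β (c z.2)) ⁻¹' {b})) ?_
  · have e1 : ∀ a, ∑ b, (Qm ν π κ).real ((fun z : X × Fin M => α z.1) ⁻¹' {a} ∩
      (fun z : X × Fin M => β (c z.2)) ⁻¹' {b}) = _ := fun a => marg_sum _ _ _ hα' hβ' a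
    have e2 : ∀ b, ∑ a, (Qm ν π κ).real ((fun z : X × Fin M => α z.1) ⁻¹' {a} ∩
      (fun z : X × Fin M => β (c z.2)) ⁻¹' {b}) =
        (Qm ν π κ).real ((fun z : X × Fin M => β (c z.2)) ⁻¹' {b}) := fun b => by
      rw [← marg_sum _ _ _ hβ' hα' b]
      exact Finset.sum_congr rfl fun a _ => by rw [inter_comm]
    simp only [e1, e2] at key
    refine le_trans (le_of_eq ?_) key
    congr 1
    refine Finset.sum_congr rfl fun ab _ => ?_
    congr 2
    ext z
    simp [Prod.ext_iff]
  · intro a b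
    rw [Qm_real ν π κ hκ ((hα' (measurableSet_singleton a)).inter (hβ' (measurableSet_singleton b))),
      Finset.sum_filter]
    refine Finset.sum_congr rfl fun j _ => ?_
    split_ifs with h
    · rw [mul_comm]
      congr 2
      ext x
      simp [h, and_comm]
    · have : {x | (x, j.2) ∈ (fun z : X × Fin M => α z.1) ⁻¹' {a} ∩
          (fun z : X × Fin M => β (c z.2)) ⁻¹' {b}} ∩ π ⁻¹' {j.1} = (∅ : Set X) := by
        ext x; simp [h]
      rw [this]; simp
end Q

theorem exists_pattern (N : ℕ) : ∃ F : (Fin (N + 1) → Prop) → Fin (N + 1),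
    ∀ σ : Fin (N + 1) → Prop, (∃ i, σ i) → σ (F σ) := by
  classical
  refine ⟨fun σ => if h : ∃ i, σ i then h.choose else 0, fun σ h => ?_⟩
  simp only [h, dif_pos]
  exact h.choose_spec

theorem exists_partition {X : Type*} [MetricSpace X] [CompactSpace X] [MeasurableSpace X]
    [BorelSpace X] (μ : Measure X) [IsProbabilityMeasure μ] (U : X → Set X) (hU : ∀ x, U x ∈ 𝓝 x) :
    ∃ (N : ℕ) (π : X → Fin N) (c : Fin N → X), Measurable π ∧ (∀ x, x ∈ U (c (π x))) ∧
      ∀ i, μ (frontier (π ⁻¹' {i})) = 0 := by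
  classical
  have h1 : ∀ x, ∃ r : ℝ, 0 < r ∧ Metric.ball x r ⊆ U x ∧ μ (frontier (Metric.ball x r)) = 0 := by
    intro x
    obtain ⟨δ, hδ, hsub⟩ := Metric.mem_nhds_iff.1 (hU x)
    obtain ⟨r, hr, h0⟩ := exists_null_frontier_thickening μ {x} hδ
    rw [Metric.thickening_singleton] at h0
    exact ⟨r, hr.1, (Metric.ball_subset_ball hr.2.le).trans hsub, h0⟩
  choose r hr hrU hr0 using h1
  obtain ⟨t, ht⟩ := isCompact_univ.elim_nhds_subcover (fun x => Metric.ball x (r x))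
    (fun x _ => Metric.ball_mem_nhds x (hr x))
  have hne : Nonempty X := nonempty_of_isProbabilityMeasure μ
  have htpos : 0 < t.card := by
    obtain ⟨x⟩ := hne
    have := ht.2 (mem_univ x)
    simp only [mem_iUnion] at this
    obtain ⟨y, hy, _⟩ := this
    exact Finset.card_pos.2 ⟨y, hy⟩
  obtain ⟨N, hN⟩ := Nat.exists_eq_succ_of_ne_zero htpos.ne'
  let e : t ≃ Fin (N + 1) := t.equivFinOfCardEq hN
  let c : Fin (N + 1) → X := fun i => (e.symm i : X)
  obtain ⟨F, hF⟩ := exists_pattern N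
  let S : Fin (N + 1) → Set X := fun i => Metric.ball (c i) (r (c i))
  let σ : X → Fin (N + 1) → Prop := fun x i => x ∈ S i
  refine ⟨N + 1, fun x => F (σ x), c, ?_, ?_, ?_⟩
  · refine (Measurable.of_discrete (f := F)).comp ?_
    refine measurable_pi_iff.2 fun i => ?_
    exact measurableSet_setOfPred.1 (Metric.isOpen_ball.measurableSet)
  · intro x
    apply hrU
    apply hF (σ x)
    have := ht.2 (mem_univ x)
    simp only [mem_iUnion] at this
    obtain ⟨y, hy, hx⟩ := this
    refine ⟨e ⟨y, hy⟩, ?_⟩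
    simpa [σ, S, c] using hx
  · intro i
    refine measure_mono_null (t := ⋃ j, frontier (S j)) ?_
      (measure_iUnion_null fun j => hr0 (c j))
    intro x hx
    by_contra hcon
    simp only [mem_iUnion, not_exists] at hcon
    have hev : ∀ᶠ y in 𝓝 x, σ y = σ x := by
      have : ∀ j, ∀ᶠ y in 𝓝 x, σ y j = σ x j := by
        intro j
        by_cases hxs : x ∈ S j
        · filter_upwards [Metric.isOpen_ball.mem_nhds hxs] with y hy
          exact propext ⟨fun _ => hxs, fun _ => hy⟩
        · have hx2 : x ∉ closure (S j) := fun hc => hcon j ⟨hc, fun hi => hxs (interior_subset hi)⟩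
          filter_upwards [isClosed_closure.isOpen_compl.mem_nhds hx2] with y hy
          exact propext ⟨fun h => absurd (subset_closure h) hy, fun h => absurd h hxs⟩
      filter_upwards [eventually_all.2 this] with y hy
      exact funext hy
    rw [frontier_eq_closure_inter_closure] at hx
    obtain ⟨y, hy1, hy2⟩ := (mem_closure_iff_frequently.1 hx.1).and_eventually hev |>.exists
    obtain ⟨z, hz1, hz2⟩ := (mem_closure_iff_frequently.1 hx.2).and_eventually hev |>.exists
    apply hz1
    simp only [mem_preimage, mem_singleton_iff] at hy1 ⊢
    rw [hz2, ← hy2, hy1]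

theorem rd_core {X : Type*} [MetricSpace X] [CompactSpace X] [MeasurableSpace X] [BorelSpace X]
    {B : Type*} [MeasurableSpace B] (D : X → B → ℝ) (C : ℝ) (hC : ∀ x y, |D x y| ≤ C)
    (hcont : ∀ x, ∀ η > 0, ∀ᶠ x' in 𝓝 x, ∀ y, |D x' y - D x y| ≤ η)
    (c : ℕ → B) (ρ : ℕ → B → ℝ) (hρm : ∀ j, Measurable (ρ j))
    (hρ : ∀ x y j, |D x (c j) - D x y| ≤ ρ j y) (hdense : ∀ y, ∀ η > 0, ∃ j, ρ j y < η)
    {Ω : Type*} [MeasurableSpace Ω] (P : Measure Ω) [IsProbabilityMeasure P]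
    (Xv : Ω → X) (Yv : Ω → B) (hX : Measurable Xv) (hY : Measurable Yv)
    (μs : ℕ → ProbabilityMeasure X) (μ : ProbabilityMeasure X)
    (hw : Tendsto μs atTop (𝓝 μ)) (hlaw : Measure.map Xv P = (μ : Measure X))
    (εs : ℕ → ℝ) (ε : ℝ) (hεw : Tendsto εs atTop (𝓝 ε))
    (hdist : ∫ ω, D (Xv ω) (Yv ω) ∂P < ε) :
    ∃ (J : ℕ → ℝ) (J₀ : ℝ) (M : ℕ) (c' : Fin M → B) (Q : ℕ → Measure (X × Fin M)),
      Tendsto J atTop (𝓝 J₀) ∧ ENNReal.ofReal J₀ ≤ mutualInfo P Xv Yv ∧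
      ∀ᶠ n in atTop, IsProbabilityMeasure (Q n) ∧ (Q n).map Prod.fst = (μs n : Measure X) ∧
        ∫ z, D z.1 (c' z.2) ∂(Q n) < εs n ∧
        mutualInfo (Q n) Prod.fst (fun z => c' z.2) ≤ ENNReal.ofReal (J n) := by
  classical
  have hDc : ∀ y, Continuous fun x => D x y := by
    intro y
    rw [continuous_iff_continuousAt]
    intro x
    rw [ContinuousAt, Metric.tendsto_nhds]
    intro e he
    filter_upwards [hcont x (e / 2) (by positivity)] with x' hx'
    rw [Real.dist_eq]
    linarith [hx' y]
  have hDm : ∀ y, Measurable fun x => D x y := fun y => (hDc y).measurable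
  have hDXY : Measurable fun ω => D (Xv ω) (Yv ω) := by
    refine measurable_of_Iio fun r => ?_
    have : (fun ω => D (Xv ω) (Yv ω)) ⁻¹' Iio r =
        ⋃ j, {ω | D (Xv ω) (c j) + ρ j (Yv ω) < r} := by
      ext ω
      simp only [mem_preimage, mem_Iio, mem_iUnion, Set.mem_ofPred_eq]
      constructor
      · intro h
        obtain ⟨j, hj⟩ := hdense (Yv ω) ((r - D (Xv ω) (Yv ω)) / 2) (by linarith)
        refine ⟨j, ?_⟩
        have := (abs_le.1 (hρ (Xv ω) (Yv ω) j)).2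
        linarith
      · rintro ⟨j, hj⟩
        have := (abs_le.1 (hρ (Xv ω) (Yv ω) j)).1
        linarith
    rw [this]
    refine MeasurableSet.iUnion fun j => ?_
    exact measurableSet_lt (((hDm (c j)).comp hX).add ((hρm j).comp hY)) measurable_const
  have hDint : Integrable (fun ω => D (Xv ω) (Yv ω)) P :=
    Integrable.of_bound hDXY.aestronglyMeasurable C (Eventually.of_forall fun _ => hC _ _)
  obtain ⟨η, hη, hη8⟩ : ∃ η > 0, ∫ ω, D (Xv ω) (Yv ω) ∂P + 8 * η = ε :=
    ⟨(ε - ∫ ω, D (Xv ω) (Yv ω) ∂P) / 8, by linarith, by ring⟩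
  -- the quantizer
  let E : ℕ → Set Ω := fun M => {ω | ∀ j ≤ M, ¬ ρ j (Yv ω) < η}
  have hEm : ∀ M, MeasurableSet (E M) := by
    intro M
    have : E M = ⋂ j, ⋂ (_ : j ≤ M), {ω | ¬ ρ j (Yv ω) < η} := by
      ext ω; simp [E]
    rw [this]
    refine MeasurableSet.iInter fun j => MeasurableSet.iInter fun _ => ?_
    exact (measurableSet_lt ((hρm j).comp hY) measurable_const).compl
  have hElim : Tendsto (fun M => P.real (E M)) atTop (𝓝 0) := by
    have h := tendsto_measure_iInter_atTop (μ := P) (s := E)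
      (fun M => (hEm M).nullMeasurableSet)
      (fun a b hab ω hω j hj => hω j (hj.trans hab)) ⟨0, measure_ne_top _ _⟩
    have h0 : ⋂ M, E M = ∅ := by
      ext ω
      simp only [mem_iInter, mem_empty_iff_false, iff_false, not_forall]
      obtain ⟨j, hj⟩ := hdense (Yv ω) η hη
      exact ⟨j, fun h => h j le_rfl hj⟩
    rw [h0, measure_empty] at h
    have h2 := (ENNReal.tendsto_toReal ENNReal.zero_ne_top).comp h
    rw [ENNReal.toReal_zero] at h2
    exact h2
  have hC0 : 0 ≤ C := by
    obtain ⟨x⟩ : Nonempty X := nonempty_of_isProbabilityMeasure (μ : Measure X)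
    exact (abs_nonneg _).trans (hC x (c 0))
  obtain ⟨M, hM⟩ : ∃ M, 2 * C * P.real (E M) < η := by
    have h := hElim.const_mul (2 * C)
    rw [mul_zero] at h
    exact (h.eventually_lt_const hη).exists
  obtain ⟨F, hF⟩ := exists_pattern M
  let β : B → Fin (M + 1) := fun y => F (fun i => ρ i y < η)
  have hβ : Measurable β := by
    refine (Measurable.of_discrete (f := F)).comp (measurable_pi_iff.2 fun i => ?_)
    exact measurableSet_setOfPred.1 (measurableSet_lt (hρm i) measurable_const)
  let c' : Fin (M + 1) → B := fun k => c k
  have hDq : Measurable fun ω => D (Xv ω) (c' (β (Yv ω))) := by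
    have h1 : Measurable (fun z : X × Fin (M + 1) => D z.1 (c' z.2)) :=
      measurable_from_prod_countable_left (f := fun z : X × Fin (M + 1) => D z.1 (c' z.2))
        fun k => hDm (c' k)
    exact h1.comp (hX.prodMk (hβ.comp hY))
  have hDqint : Integrable (fun ω => D (Xv ω) (c' (β (Yv ω)))) P :=
    Integrable.of_bound hDq.aestronglyMeasurable C (Eventually.of_forall fun _ => hC _ _)
  have hquant : ∫ ω, D (Xv ω) (c' (β (Yv ω))) ∂P ≤ ∫ ω, D (Xv ω) (Yv ω) ∂P + 2 * η := by
    have hindI : Integrable ((E M).indicator fun _ => 2 * C) P :=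
      (integrable_const _).indicator (hEm M)
    have h1 : ∫ ω, D (Xv ω) (c' (β (Yv ω))) ∂P ≤
        ∫ ω, (D (Xv ω) (Yv ω) + η) + (E M).indicator (fun _ => 2 * C) ω ∂P := by
      refine integral_mono hDqint ((hDint.add (integrable_const _)).add hindI) fun ω => ?_
      by_cases hω : ω ∈ E M
      · simp only [indicator_of_mem hω]
        have := (abs_le.1 (hC (Xv ω) (c' (β (Yv ω))))).2
        have := (abs_le.1 (hC (Xv ω) (Yv ω))).1
        linarith
      · simp only [indicator_of_notMem hω]
        simp only [E, Set.mem_ofPred_eq, not_forall, not_not] at hω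
        obtain ⟨j, hj, hj2⟩ := hω
        have h2 := hF (fun i => ρ i (Yv ω) < η) ⟨⟨j, by omega⟩, hj2⟩
        have h3 : ρ (β (Yv ω)) (Yv ω) < η := h2
        have h4 := (abs_le.1 (hρ (Xv ω) (Yv ω) (β (Yv ω)))).2
        simp only [c']
        linarith
    have hDη : Integrable (fun ω => D (Xv ω) (Yv ω) + η) P := hDint.add (integrable_const _)
    rw [integral_add hDη hindI, integral_add hDint (integrable_const _),
      integral_indicator (hEm M)] at h1
    simp only [integral_const, smul_eq_mul, measureReal_restrict_apply_univ, probReal_univ,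
      one_mul] at h1
    linarith
  -- the partition
  obtain ⟨N, π, zc, hπ, hπz, hπf⟩ := exists_partition (μ : Measure X)
    (fun x => {x' | ∀ y, |D x' y - D x y| ≤ η}) (fun x => hcont x η hη)
  let p : Fin N → ℝ := fun i => (μ : Measure X).real (π ⁻¹' {i})
  let jt : Fin N → Fin (M + 1) → ℝ := fun i k =>
    P.real ((fun ω => π (Xv ω)) ⁻¹' {i} ∩ (fun ω => β (Yv ω)) ⁻¹' {k})
  have hπX : Measurable fun ω => π (Xv ω) := hπ.comp hX
  have hβY : Measurable fun ω => β (Yv ω) := hβ.comp hY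
  have hpP : ∀ i, P.real ((fun ω => π (Xv ω)) ⁻¹' {i}) = p i := by
    intro i
    simp only [p, ← hlaw]
    rw [map_measureReal_apply hX (hπ (measurableSet_singleton i))]
    rfl
  have hjt1 : ∀ i, ∑ k, jt i k = p i := fun i => by
    rw [← hpP]; exact marg_sum P _ _ hπX hβY i
  have hjt0 : ∀ i k, 0 ≤ jt i k := fun i k => measureReal_nonneg
  let κ : Fin N → Fin (M + 1) → ℝ := fun i k =>
    if p i = 0 then (if k = 0 then 1 else 0) else jt i k / p i
  have hκ : ∀ i k, 0 ≤ κ i k := by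
    intro i k
    simp only [κ]
    split_ifs
    · norm_num
    · norm_num
    · exact div_nonneg (hjt0 i k) measureReal_nonneg
  have hκ1 : ∀ i, ∑ k, κ i k = 1 := by
    intro i
    simp only [κ]
    split_ifs with h
    · simp
    · rw [← Finset.sum_div, hjt1, div_self h]
  have hpκ : ∀ i k, p i * κ i k = jt i k := by
    intro i k
    simp only [κ]
    split_ifs with h h2
    · rw [h, zero_mul]
      exact ((Finset.sum_eq_zero_iff_of_nonneg (fun k _ => hjt0 i k)).1
        ((hjt1 i).trans h) k (Finset.mem_univ _)).symm
    · rw [h, zero_mul]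
      exact ((Finset.sum_eq_zero_iff_of_nonneg (fun k _ => hjt0 i k)).1
        ((hjt1 i).trans h) k (Finset.mem_univ _)).symm
    · field_simp
  have hplim : ∀ i, Tendsto (fun n => (μs n : Measure X).real (π ⁻¹' {i})) atTop (𝓝 (p i)) := by
    intro i
    exact (ENNReal.tendsto_toReal (measure_ne_top _ _)).comp
      (ProbabilityMeasure.tendsto_measure_of_null_frontier_of_tendsto' hw (hπf i))
  refine ⟨fun n => Jfun κ fun i => (μs n : Measure X).real (π ⁻¹' {i}), Jfun κ p, M + 1, c',
    fun n => Qm (μs n : Measure X) π κ, ?_, ?_, ?_⟩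
  · exact ((Jfun_cont κ).tendsto p).comp (tendsto_pi_nhds.2 hplim)
  · unfold mutualInfo
    refine le_trans (le_of_eq ?_) (le_iSup_of_le N <| le_iSup_of_le (M + 1) <| le_iSup_of_le π <|
      le_iSup_of_le hπ <| le_iSup_of_le β <| le_iSup_of_le hβ <| le_rfl)
    congr 1
    rw [shannonEntropy_eq, shannonEntropy_eq, shannonEntropy_eq, ← add_div, ← sub_div, Jfun]
    simp only [hpκ, hpP]
    congr 2
    · congr 1
      refine Finset.sum_congr rfl fun k _ => ?_
      congr 1
      rw [← marg_sum P _ _ hβY hπX k]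
      exact Finset.sum_congr rfl fun i _ => by rw [inter_comm]
    · refine Finset.sum_congr rfl fun ik _ => ?_
      simp only [jt]
      congr 2
      ext ω
      simp [Prod.ext_iff]
  · let G : Fin N → Fin (M + 1) → ℝ := fun i k => D (zc i) (c' k) + η
    have hlim : Tendsto (fun n => ∑ j : Fin N × Fin (M + 1),
        κ j.1 j.2 * ((μs n : Measure X).real (π ⁻¹' {j.1}) * G j.1 j.2)) atTop
        (𝓝 (∑ j : Fin N × Fin (M + 1), κ j.1 j.2 * (p j.1 * G j.1 j.2))) :=
      tendsto_finsetSum _ fun j _ => ((hplim j.1).mul_const _).const_mul _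
    have hbound : ∑ j : Fin N × Fin (M + 1), κ j.1 j.2 * (p j.1 * G j.1 j.2) < ε := by
      have e1 : ∑ j : Fin N × Fin (M + 1), κ j.1 j.2 * (p j.1 * G j.1 j.2)
          = ∫ ω, G (π (Xv ω)) (β (Yv ω)) ∂P := by
        have hm : Measurable fun ω => (π (Xv ω), β (Yv ω)) := hπX.prodMk hβY
        have : ∫ ω, G (π (Xv ω)) (β (Yv ω)) ∂P =
            ∫ j, G j.1 j.2 ∂(P.map fun ω => (π (Xv ω), β (Yv ω))) := by
          rw [integral_map hm.aemeasurable
            (Measurable.of_discrete (f := fun j : Fin N × Fin (M+1) => G j.1 j.2)).aestronglyMeasurable]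
        have := Measure.isProbabilityMeasure_map (μ := P) hm.aemeasurable
        rw [‹∫ ω, G (π (Xv ω)) (β (Yv ω)) ∂P = _›, integral_fintype .of_finite]
        refine Finset.sum_congr rfl fun j _ => ?_
        rw [map_measureReal_apply hm (measurableSet_singleton j), smul_eq_mul]
        have : (fun ω => (π (Xv ω), β (Yv ω))) ⁻¹' {j} =
          (fun ω => π (Xv ω)) ⁻¹' {j.1} ∩ (fun ω => β (Yv ω)) ⁻¹' {j.2} := by
          ext ω; simp [Prod.ext_iff]
        rw [this]
        change _ = jt j.1 j.2 * _
        rw [← hpκ]; ring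
      have e2 : ∫ ω, G (π (Xv ω)) (β (Yv ω)) ∂P ≤ ∫ ω, D (Xv ω) (c' (β (Yv ω))) + 2 * η ∂P := by
        have hGm : Measurable fun ω => G (π (Xv ω)) (β (Yv ω)) :=
          (Measurable.of_discrete (f := fun j : Fin N × Fin (M+1) => G j.1 j.2)).comp
            (hπX.prodMk hβY)
        refine integral_mono (Integrable.of_bound hGm.aestronglyMeasurable (C + η)
          (Eventually.of_forall fun ω => ?_)) (hDqint.add (integrable_const _)) fun ω => ?_
        · refine (norm_add_le _ _).trans (add_le_add (hC _ _) ?_)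
          rw [Real.norm_eq_abs, abs_of_pos hη]
        · have := (abs_le.1 (hπz (Xv ω) (c' (β (Yv ω))))).1
          simp only [G]
          linarith
      rw [integral_add hDqint (integrable_const _)] at e2
      simp only [integral_const, smul_eq_mul, probReal_univ, one_mul] at e2
      linarith
    filter_upwards [hlim.eventually_lt hεw hbound] with n hn
    refine ⟨Qm_prob _ π hπ κ hκ hκ1, Qm_fst _ π hπ κ hκ hκ1, lt_of_le_of_lt ?_ hn,
      Qm_mutualInfo _ π hπ κ hκ hκ1 c'⟩
    refine Qm_integral_le (μs n : Measure X) π hπ κ hκ (fun x k => D x (c' k)) (fun k => hDm _) G C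
      (fun x k => hC _ _) fun x k => ?_
    have := (abs_le.1 (hπz x (c' k))).2
    simp only [G]
    linarith

theorem RL_le_of_coupling {X : Type*} [MetricSpace X] [CompactSpace X] [MeasurableSpace X]
    [BorelSpace X] (d : ℕ) (T : (Fin d → ℝ) → X → X) (ν : Measure X) (L ε : ℝ)
    {M : ℕ} (c : Fin M → L1Maps d L X) (Q : Measure (X × Fin M)) [IsProbabilityMeasure Q]
    (hfst : Q.map Prod.fst = ν) (D : X → L1Maps d L X → ℝ)
    (hD : ∀ x y, D x y = (L ^ d)⁻¹ * ∫ u, dist (T u x) (y u) ∂(boxMeasure d L))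
    (hDm : ∀ y, Measurable fun x => D x y)
    (hdist : ∫ z, D z.1 (c z.2) ∂Q < ε) :
    RL d T ν L ε ≤ mutualInfo Q Prod.fst (fun z => c z.2) := by
  obtain ⟨z₀⟩ : Nonempty (X × Fin M) := nonempty_of_isProbabilityMeasure Q
  have : Nonempty X := ⟨z₀.1⟩
  obtain ⟨e, he⟩ := exists_measurableEmbedding_real X
  obtain ⟨g, hg, hge⟩ := he.exists_measurable_extend measurable_id (fun _ => inferInstance)
  have hge' : ∀ x, g (e x) = x := fun x => congrFun hge x
  let h : X × Fin M → ℝ × Fin M := fun z => (e z.1, z.2)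
  have hh : Measurable h := (he.measurable.comp measurable_fst).prodMk measurable_snd
  let P : Measure (ℝ × Fin M) := Q.map h
  have hP : IsProbabilityMeasure P := Measure.isProbabilityMeasure_map hh.aemeasurable
  let Xv : ℝ × Fin M → X := fun w => g w.1
  let Yv : ℝ × Fin M → L1Maps d L X := fun w => c w.2
  have hXv : Measurable Xv := hg.comp measurable_fst
  have hYv : Measurable Yv := (Measurable.of_discrete (f := c)).comp measurable_snd
  have hXh : Xv ∘ h = Prod.fst := by funext z; exact hge' z.1
  have hlaw : P.map Xv = ν := by
    rw [Measure.map_map hXv hh, hXh, hfst]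
  have hds : distortion d T L P Xv Yv < ε := by
    unfold distortion
    have h1 : Measurable (fun z : X × Fin M => D z.1 (c z.2)) :=
      measurable_from_prod_countable_left (f := fun z : X × Fin M => D z.1 (c z.2))
        fun k => hDm (c k)
    have hm : Measurable (fun w : ℝ × Fin M => D (Xv w) (Yv w)) :=
      h1.comp (hXv.prodMk measurable_snd)
    simp only [← hD]
    rw [integral_map hh.aemeasurable hm.aestronglyMeasurable]
    have : ∀ z, D (Xv (h z)) (Yv (h z)) = D z.1 (c z.2) := fun z => by
      simp only [Xv, Yv, h, hge']
    simpa only [this] using hdist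
  have hent : ∀ {S : Type} [Fintype S] [MeasurableSpace S] [MeasurableSingletonClass S]
      (f : ℝ × Fin M → S), Measurable f →
      shannonEntropy P f = shannonEntropy Q (fun z => f (h z)) := by
    intro S _ _ _ f hf
    unfold shannonEntropy
    congr 1
    refine Finset.sum_congr rfl fun i _ => ?_
    simp only [P]
    rw [Measure.map_apply hh (hf (measurableSet_singleton i))]
    rfl
  have hmi : mutualInfo P Xv Yv ≤ mutualInfo Q Prod.fst (fun z => c z.2) := by
    unfold mutualInfo
    refine iSup_mono fun n => iSup_mono fun m => iSup_mono fun α => iSup_mono fun hα =>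
      iSup_mono fun β => iSup_mono fun hβ => le_of_eq ?_
    rw [hent (fun ω => α (Xv ω)) (hα.comp hXv), hent (fun ω => β (Yv ω)) (hβ.comp hYv),
      hent (fun ω => (α (Xv ω), β (Yv ω))) ((hα.comp hXv).prodMk (hβ.comp hYv))]
    simp only [Xv, Yv, h, hge', Function.comp_apply]
  refine le_trans ?_ hmi
  unfold RL
  exact iInf_le_of_le (ℝ × Fin M) <| iInf_le_of_le inferInstance <| iInf_le_of_le P <|
    iInf_le_of_le hP <| iInf_le_of_le Xv <| iInf_le_of_le Yv <| iInf_le_of_le hXv <|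
    iInf_le_of_le hYv <| iInf_le_of_le hlaw <| iInf_le_of_le hds le_rfl

instance boxMeasure_finite (d : ℕ) (L : ℝ) : IsFiniteMeasure (boxMeasure d L) := by
  constructor
  rw [boxMeasure, Measure.restrict_apply_univ, unitBox, Real.volume_pi_Ico]
  exact ENNReal.prod_lt_top fun i _ => ENNReal.ofReal_lt_top

theorem boxMeasure_real (d : ℕ) (L : ℝ) (hL : 0 < L) : (boxMeasure d L).real univ = L ^ d := by
  rw [Measure.real, boxMeasure, Measure.restrict_apply_univ, unitBox, Real.volume_pi_Ico_toReal]
  · simp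
  · intro i; exact hL.le

theorem dist_integrable {X : Type*} [MetricSpace X] [CompactSpace X] {d : ℕ} {L : ℝ}
    {f g : (Fin d → ℝ) → X} (hf : AEStronglyMeasurable f (boxMeasure d L))
    (hg : AEStronglyMeasurable g (boxMeasure d L)) :
    Integrable (fun u => dist (f u) (g u)) (boxMeasure d L) := by
  refine Integrable.of_bound (hf.dist hg) (Metric.diam (univ : Set X))
    (Eventually.of_forall fun u => ?_)
  rw [Real.norm_eq_abs, abs_of_nonneg dist_nonneg]
  exact Metric.dist_le_diam_of_mem isCompact_univ.isBounded (mem_univ _) (mem_univ _)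

theorem L1Maps_dense {X : Type*} [MetricSpace X] [CompactSpace X] [Nonempty X] (d : ℕ) (L : ℝ) :
    ∃ c : ℕ → L1Maps d L X, ∀ y : L1Maps d L X, ∀ η > 0, ∃ j, L1dist (c j) y < η := by
  classical
  letI : MeasurableSpace X := borel X
  have : BorelSpace X := ⟨rfl⟩
  have : Fact ((1 : ℝ≥0∞) ≠ ∞) := ⟨by simp⟩
  let ι : X → C(X, ℝ) := fun x => ⟨fun z => dist x z, by fun_prop⟩
  have hι : Isometry ι := by
    refine Isometry.of_dist_eq fun x y => le_antisymm ?_ ?_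
    · refine (ContinuousMap.dist_le dist_nonneg).2 fun z => ?_
      exact abs_dist_sub_le x y z
    · have h := ContinuousMap.dist_apply_le_dist (f := ι x) (g := ι y) y
      simpa [ι, Real.dist_eq] using h
  have hmem : ∀ f : L1Maps d L X, MemLp (fun u => ι (f u)) 1 (boxMeasure d L) := by
    intro f
    have hb : IsCompact (range ι) := isCompact_range hι.continuous
    obtain ⟨K, hK⟩ := hb.isBounded.exists_norm_le
    exact MemLp.of_bound (hι.continuous.comp_aestronglyMeasurable f.aestronglyMeasurable) K
      (Eventually.of_forall fun u => hK _ (mem_range_self _))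
  let Φ : L1Maps d L X → Lp C(X, ℝ) 1 (boxMeasure d L) := fun f => (hmem f).toLp _
  have hΦ : ∀ f g, dist (Φ f) (Φ g) = L1dist f g := by
    intro f g
    rw [L1.dist_eq_integral_dist, L1dist]
    refine integral_congr_ae ?_
    filter_upwards [(hmem f).coeFn_toLp, (hmem g).coeFn_toLp] with u h1 h2
    simp only [Φ]
    rw [h1, h2, hι.dist_eq]
  have : SecondCountableTopology (Lp C(X, ℝ) 1 (boxMeasure d L)) := by
    unfold boxMeasure; infer_instance
  have : Nonempty (L1Maps d L X) := ⟨AEEqFun.const _ (Classical.arbitrary X)⟩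
  obtain ⟨s, hs⟩ := TopologicalSpace.exists_dense_seq (range Φ)
  choose c hc using fun j => (s j).2
  refine ⟨c, fun y η hη => ?_⟩
  obtain ⟨j, hj⟩ := hs.exists_dist_lt (⟨Φ y, mem_range_self y⟩ : range Φ) hη
  refine ⟨j, ?_⟩
  rw [← hΦ, hc, dist_comm]
  exact hj

section final
variable {X : Type*} [MetricSpace X] [CompactSpace X] (d : ℕ) (T : (Fin d → ℝ) → X → X)

theorem orbit_meas (hT : IsContAction d T) (L : ℝ) (x : X) :
    AEStronglyMeasurable (fun u => T u x) (boxMeasure d L) := by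
  have : Continuous fun u => T u x := hT.1.comp (by fun_prop : Continuous fun u => (u, x))
  exact this.aestronglyMeasurable

theorem Dcont (hT : IsContAction d T) (L : ℝ) (hL : 0 < L) (x : X) (η : ℝ) (hη : 0 < η) :
    ∀ᶠ x' in 𝓝 x, ∀ y : L1Maps d L X,
      |(L ^ d)⁻¹ * ∫ u, dist (T u x') (y u) ∂(boxMeasure d L)
        - (L ^ d)⁻¹ * ∫ u, dist (T u x) (y u) ∂(boxMeasure d L)| ≤ η := by
  have hLd : 0 < L ^ d := by positivity
  have hK : IsCompact (univ.pi fun _ : Fin d => Icc (0 : ℝ) L) :=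
    isCompact_univ_pi fun _ => isCompact_Icc
  have hev : ∀ᶠ x' in 𝓝 x, ∀ u ∈ (univ.pi fun _ : Fin d => Icc (0 : ℝ) L),
      dist (T u x') (T u x) < η := by
    refine hK.eventually_forall_of_forall_eventually fun u _ => ?_
    have hc1 : Continuous fun z : X × (Fin d → ℝ) => T z.2 z.1 :=
      hT.1.comp (by fun_prop : Continuous fun z : X × (Fin d → ℝ) => (z.2, z.1))
    have hc2 : Continuous fun z : X × (Fin d → ℝ) => T z.2 x :=
      hT.1.comp (by fun_prop : Continuous fun z : X × (Fin d → ℝ) => (z.2, x))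
    refine (hc1.dist hc2).continuousAt.eventually_lt continuousAt_const ?_
    simpa using hη
  filter_upwards [hev] with x' hx' y
  have i1 := dist_integrable (orbit_meas d T hT L x') y.aestronglyMeasurable
  have i2 := dist_integrable (orbit_meas d T hT L x) y.aestronglyMeasurable
  rw [← mul_sub, abs_mul, abs_of_pos (inv_pos.2 hLd), ← integral_sub i1 i2]
  have hb : ‖∫ u, (dist (T u x') (y u) - dist (T u x) (y u)) ∂(boxMeasure d L)‖
      ≤ η * (boxMeasure d L).real univ := by
    refine norm_integral_le_of_norm_le_const ?_
    have hms : MeasurableSet (unitBox d L) := MeasurableSet.univ_pi fun _ => measurableSet_Ico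
    have hae : ∀ᵐ u ∂(boxMeasure d L), u ∈ unitBox d L := ae_restrict_mem hms
    filter_upwards [hae] with u hu
    exact (abs_dist_sub_le _ _ _).trans
      (hx' u fun i _ => ⟨(hu i (mem_univ i)).1, (hu i (mem_univ i)).2.le⟩).le
  rw [boxMeasure_real d L hL, Real.norm_eq_abs] at hb
  calc _ ≤ (L ^ d)⁻¹ * (η * L ^ d) := mul_le_mul_of_nonneg_left hb (inv_pos.2 hLd).le
    _ = η := by field_simp

theorem Dbound (L : ℝ) (hL : 0 < L) (x : X) (y : L1Maps d L X) :
    |(L ^ d)⁻¹ * ∫ u, dist (T u x) (y u) ∂(boxMeasure d L)| ≤ Metric.diam (univ : Set X) := by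
  have hLd : 0 < L ^ d := by positivity
  rw [abs_mul, abs_of_pos (inv_pos.2 hLd)]
  have hb : ‖∫ u, dist (T u x) (y u) ∂(boxMeasure d L)‖
      ≤ Metric.diam (univ : Set X) * (boxMeasure d L).real univ := by
    refine norm_integral_le_of_norm_le_const (Eventually.of_forall fun u => ?_)
    rw [Real.norm_eq_abs, abs_of_nonneg dist_nonneg]
    exact Metric.dist_le_diam_of_mem isCompact_univ.isBounded (mem_univ _) (mem_univ _)
  rw [boxMeasure_real d L hL, Real.norm_eq_abs] at hb
  calc _ ≤ (L ^ d)⁻¹ * (Metric.diam (univ : Set X) * L ^ d) :=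
        mul_le_mul_of_nonneg_left hb (inv_pos.2 hLd).le
    _ = _ := by field_simp

theorem Dtri (hT : IsContAction d T) (L : ℝ) (hL : 0 < L) (x : X) (c y : L1Maps d L X) :
    |(L ^ d)⁻¹ * ∫ u, dist (T u x) (c u) ∂(boxMeasure d L)
      - (L ^ d)⁻¹ * ∫ u, dist (T u x) (y u) ∂(boxMeasure d L)| ≤ (L ^ d)⁻¹ * L1dist c y := by
  have hLd : 0 < L ^ d := by positivity
  have i1 := dist_integrable (orbit_meas d T hT L x) c.aestronglyMeasurable
  have i2 := dist_integrable (orbit_meas d T hT L x) y.aestronglyMeasurable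
  rw [← mul_sub, abs_mul, abs_of_pos (inv_pos.2 hLd), ← integral_sub i1 i2]
  refine mul_le_mul_of_nonneg_left ?_ (inv_pos.2 hLd).le
  refine (norm_integral_le_integral_norm
    (fun u => dist (T u x) (c u) - dist (T u x) (y u))).trans ?_
  rw [L1dist]
  refine integral_mono (i1.sub i2).norm
    (dist_integrable c.aestronglyMeasurable y.aestronglyMeasurable) fun u => ?_
  have := abs_dist_sub_le (c u) (y u) (T u x)
  simpa [dist_comm, Real.norm_eq_abs] using this

theorem L1dist_meas (L : ℝ) (c : L1Maps d L X) : Measurable (fun y => L1dist c y) := by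
  refine measurable_of_Iio fun r => ?_
  exact MeasurableSpace.measurableSet_generateFrom ⟨c, r, rfl⟩

end final

/-- Lemma 3.4: the rate distortion function `R(𝐝, μ, ε)` is upper semicontinuous in `(μ, ε)`. -/
theorem RD_upper_semicontinuous
    {X : Type*} [MetricSpace X] [CompactSpace X] [MeasurableSpace X] [BorelSpace X]
    (d : ℕ) (hd : 0 < d) (T : (Fin d → ℝ) → X → X) (hT : IsContAction d T)
    (μs : ℕ → ProbabilityMeasure X) (hμs : ∀ n, MeasInvariant d T (μs n : Measure X))
    (μ : ProbabilityMeasure X) (hμ : MeasInvariant d T (μ : Measure X))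
    (hw : Filter.Tendsto μs Filter.atTop (nhds μ))
    (εs : ℕ → ℝ) (hεs : ∀ n, 0 < εs n) (ε : ℝ) (hε : 0 < ε)
    (hεw : Filter.Tendsto εs Filter.atTop (nhds ε)) :
    Filter.limsup (fun n => RD d T (μs n : Measure X) (εs n)) Filter.atTop
      ≤ RD d T (μ : Measure X) ε := by


  unfold RD
  refine le_iInf fun L => le_iInf fun hL => ?_
  have hLd : 0 < L ^ d := by positivity
  have hc0 : ENNReal.ofReal (L ^ d) ≠ 0 := by simpa using hLd
  rw [ENNReal.le_div_iff_mul_le (Or.inl hc0) (Or.inl ENNReal.ofReal_ne_top)]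
  conv_rhs => unfold RL
  refine le_iInf fun Ω => le_iInf fun mΩ => le_iInf fun P => le_iInf fun hP => le_iInf fun Xv =>
    le_iInf fun Yv => le_iInf fun hX => le_iInf fun hY => le_iInf fun hlaw => le_iInf fun hdist => ?_
  rw [← ENNReal.le_div_iff_mul_le (Or.inl hc0) (Or.inl ENNReal.ofReal_ne_top)]
  haveI : Nonempty X := nonempty_of_isProbabilityMeasure (μ : Measure X)
  let D : X → L1Maps d L X → ℝ := fun x y =>
    (L ^ d)⁻¹ * ∫ u, dist (T u x) (y u) ∂(boxMeasure d L)
  obtain ⟨c, hc⟩ := L1Maps_dense (X := X) d L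
  obtain ⟨J, J₀, M, c', Q, hJ, hJ₀, hQ⟩ := rd_core D (Metric.diam (univ : Set X))
    (fun x y => Dbound d T L hL x y) (fun x η hη => Dcont d T hT L hL x η hη) c
    (fun j y => (L ^ d)⁻¹ * L1dist (c j) y) (fun j => (L1dist_meas d L (c j)).const_mul _)
    (fun x y j => Dtri d T hT L hL x (c j) y) (fun y η hη => by
      obtain ⟨j, hj⟩ := hc y (η * L ^ d) (by positivity)
      refine ⟨j, ?_⟩
      rw [inv_mul_lt_iff₀ hLd, mul_comm]
      exact hj) P Xv Yv hX hY μs μ hw hlaw εs ε hεw hdist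
  have hDm : ∀ y, Measurable fun x => D x y := fun y => by
    refine Continuous.measurable (continuous_iff_continuousAt.2 fun x => ?_)
    rw [ContinuousAt, Metric.tendsto_nhds]
    intro e he
    filter_upwards [Dcont d T hT L hL x (e / 2) (by positivity)] with x' hx'
    rw [Real.dist_eq]
    have := hx' y
    simp only [D]
    linarith
  have hlim : Tendsto (fun n => ENNReal.ofReal (J n) / ENNReal.ofReal (L ^ d)) atTop
      (𝓝 (ENNReal.ofReal J₀ / ENNReal.ofReal (L ^ d))) :=
    ENNReal.Tendsto.div_const ((ENNReal.continuous_ofReal.tendsto _).comp hJ) (Or.inr hc0)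
  refine le_trans ?_ (ENNReal.div_le_div_right hJ₀ _)
  rw [← hlim.limsup_eq]
  refine limsup_le_limsup ?_
  filter_upwards [hQ] with n hn
  obtain ⟨h1, h2, h3, h4⟩ := hn
  refine iInf_le_of_le L (iInf_le_of_le hL (ENNReal.div_le_div_right ?_ _))
  exact (RL_le_of_coupling d T (μs n : Measure X) L (εs n) c' (Q n) h2 D (fun _ _ => rfl) hDm
    h3).trans h4
end

section
/- Let T : ℝ^d × 𝒳 → 𝒳 be a continuous action of ℝ^d on a compact metric space (𝒳, 𝐝). Let p_0, p_1 ∈ [0,1] with p_0 + p_1 = 1, let μ_0, μ_1 ∈ M^T(𝒳), and let ε_0, ε_1 > 0. Then R(𝐝, p_0μ_0 + p_1μ_1, p_0ε_0 + p_1ε_1) ≤ p_0 R(𝐝, μ_0, ε_0) + p_1 R(𝐝, μ_1, ε_1). In particular, for each μ ∈ M^T(𝒳) the function (0,∞) ∋ ε ↦ R(𝐝, μ, ε) is continuous. -/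
open MeasureTheory Filter Set
open scoped ENNReal Topology NNReal

section FiniteLemmas

/-- log-sum inequality -/
lemma rd_log_sum {ι : Type*} (s : Finset ι) (q p : ι → ℝ) (hq : ∀ i ∈ s, 0 ≤ q i)
    (hp : ∀ i ∈ s, 0 ≤ p i) (hac : ∀ i ∈ s, p i = 0 → q i = 0) :
    (∑ i ∈ s, q i) * Real.log ((∑ i ∈ s, q i) / ∑ i ∈ s, p i)
      ≤ ∑ i ∈ s, q i * Real.log (q i / p i) := by
  set Q := ∑ i ∈ s, q i with hQ
  set R := ∑ i ∈ s, p i with hR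
  have hQ0 : 0 ≤ Q := Finset.sum_nonneg hq
  have hR0 : 0 ≤ R := Finset.sum_nonneg hp
  rcases hQ0.eq_or_lt with h | hQpos
  · rw [← h]
    have : ∀ i ∈ s, q i = 0 := (Finset.sum_eq_zero_iff_of_nonneg hq).1 h.symm
    rw [Finset.sum_eq_zero]
    · simp
    · intro i hi; simp [this i hi]
  have hRpos : 0 < R := by
    rcases hR0.eq_or_lt with h | h
    · have : ∀ i ∈ s, p i = 0 := (Finset.sum_eq_zero_iff_of_nonneg hp).1 h.symm
      have : Q = 0 := Finset.sum_eq_zero fun i hi => hac i hi (this i hi)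
      linarith
    · exact h
  have key : ∀ i ∈ s, q i * Real.log (Q / R) + q i - p i * (Q / R) ≤ q i * Real.log (q i / p i) := by
    intro i hi
    rcases (hq i hi).eq_or_lt with h | hqi
    · rw [← h]
      have := mul_nonneg (hp i hi) (div_pos hQpos hRpos).le
      simp; exact this
    have hpi : 0 < p i := by
      rcases (hp i hi).eq_or_lt with h | h
      · have := hac i hi h.symm; linarith
      · exact h
    have h1 := Real.log_le_sub_one_of_pos (x := (Q / R) / (q i / p i)) (by positivity)
    rw [Real.log_div (by positivity) (by positivity)] at h1
    have h2 : q i * ((Q / R) / (q i / p i)) = p i * (Q / R) := by field_simp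
    nlinarith [mul_le_mul_of_nonneg_left h1 hqi.le]
  have := Finset.sum_le_sum key
  rw [Finset.sum_sub_distrib, Finset.sum_add_distrib, ← Finset.sum_mul, ← Finset.sum_mul] at this
  have h3 : R * (Q / R) = Q := by field_simp
  rw [← hQ, ← hR, h3] at this
  linarith

lemma rd_sum_prod_marg {κ B : Type*} [Fintype κ] [DecidableEq κ] [Fintype B]
    (w : κ → B → ℝ) (hw : ∀ k, ∑ b, w k b = 1) (k₀ : κ) (h : B → ℝ) :
    ∑ b : κ → B, (∏ k, w k (b k)) * h (b k₀) = ∑ b, w k₀ b * h b := by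
  have h1 : ∀ b : κ → B, (∏ k, w k (b k)) * h (b k₀)
      = ∏ k, (w k (b k) * if k = k₀ then h (b k) else 1) := by
    intro b
    rw [Finset.prod_mul_distrib]
    simp
  simp_rw [h1]
  rw [← Fintype.prod_sum (fun k b => w k b * if k = k₀ then h b else 1)]
  rw [Finset.prod_eq_single k₀]
  · simp
  · intro k _ hk
    simp [hk, hw]
  · simp

/-- product relative entropy -/
lemma rd_sum_prod_kl {κ B : Type*} [Fintype κ] [DecidableEq κ] [Fintype B]
    (w : κ → B → ℝ) (hw : ∀ k, ∑ b, w k b = 1) (ρ : B → ℝ)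
    (hac : ∀ k b, ρ b = 0 → w k b = 0) :
    ∑ b : κ → B, (∏ k, w k (b k)) * Real.log ((∏ k, w k (b k)) / ∏ k, ρ (b k))
      = ∑ k, ∑ b, w k b * Real.log (w k b / ρ b) := by
  have h1 : ∀ b : κ → B, (∏ k, w k (b k)) * Real.log ((∏ k, w k (b k)) / ∏ k, ρ (b k))
      = ∑ k₀, (∏ k, w k (b k)) * Real.log (w k₀ (b k₀) / ρ (b k₀)) := by
    intro b
    rw [← Finset.mul_sum]
    by_cases h0 : (∏ k, w k (b k)) = 0
    · simp [h0]
    · rw [← Finset.prod_div_distrib, Real.log_prod]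
      intro k _
      have : w k (b k) ≠ 0 := fun h => h0 (Finset.prod_eq_zero (Finset.mem_univ k) h)
      exact div_ne_zero this fun h => this (hac k _ h)
  simp_rw [h1]
  rw [Finset.sum_comm]
  refine Finset.sum_congr rfl fun k₀ _ => ?_
  exact rd_sum_prod_marg w hw k₀ (fun b => Real.log (w k₀ b / ρ b))

/-- disintegration of a finite joint law -/
lemma rd_disint {A B : Type*} [Fintype B] (p : A → ℝ) (q : A → B → ℝ)
    (hq : ∀ a b, 0 ≤ q a b) (hpq : ∀ a, ∑ b, q a b = p a) (ρ : B → ℝ) (hρ : ∀ b, 0 ≤ ρ b)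
    (hρ1 : ∑ b, ρ b = 1) (hac : ∀ a b, ρ b = 0 → q a b = 0) :
    ∃ W : A → B → ℝ, (∀ a b, 0 ≤ W a b) ∧ (∀ a, ∑ b, W a b = 1) ∧
      (∀ a b, ρ b = 0 → W a b = 0) ∧ ∀ a b, p a * W a b = q a b := by
  classical
  have hp : ∀ a, 0 ≤ p a := fun a => hpq a ▸ Finset.sum_nonneg fun b _ => hq a b
  refine ⟨fun a b => if p a = 0 then ρ b else q a b / p a, ?_, ?_, ?_, ?_⟩
  · intro a b
    dsimp only
    split_ifs
    · exact hρ b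
    · exact div_nonneg (hq a b) (hp a)
  · intro a
    dsimp only
    split_ifs with h
    · exact hρ1
    · rw [← Finset.sum_div, hpq, div_self h]
  · intro a b hb
    dsimp only
    split_ifs
    · exact hb
    · simp [hac a b hb]
  · intro a b
    dsimp only
    split_ifs with h
    · have := (Finset.sum_eq_zero_iff_of_nonneg fun b _ => hq a b).1 ((hpq a).trans h)
      simp [h, this b (Finset.mem_univ b)]
    · field_simp

/-- The entropy expression in terms of relative entropy. -/
lemma rd_mi_eq {Ω S S' : Type*} [MeasurableSpace Ω] [Fintype S] [Fintype S']
    (P : Measure Ω) [IsFiniteMeasure P] (f : Ω → S) (g : Ω → S')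
    (hf : ∀ i, MeasurableSet (f ⁻¹' {i})) (hg : ∀ i, MeasurableSet (g ⁻¹' {i})) :
    shannonEntropy P f + shannonEntropy P g - shannonEntropy P (fun ω => (f ω, g ω))
      = (∑ i, ∑ j, P.real (f ⁻¹' {i} ∩ g ⁻¹' {j}) *
          Real.log (P.real (f ⁻¹' {i} ∩ g ⁻¹' {j}) / (P.real (f ⁻¹' {i}) * P.real (g ⁻¹' {j}))))
        / Real.log 2 := by
  have m1 : ∀ i, P.real (f ⁻¹' {i}) = ∑ j, P.real (f ⁻¹' {i} ∩ g ⁻¹' {j}) := by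
    intro i
    rw [← measureReal_biUnion_finset]
    · congr 1; ext ω; simp
    · intro j _ j' _ hjj
      refine Set.disjoint_left.2 ?_
      rintro ω ⟨_, h⟩ ⟨_, h'⟩
      exact hjj (h.symm.trans h')
    · intro j _; exact (hf i).inter (hg j)
  have m2 : ∀ j, P.real (g ⁻¹' {j}) = ∑ i, P.real (f ⁻¹' {i} ∩ g ⁻¹' {j}) := by
    intro i
    rw [← measureReal_biUnion_finset]
    · congr 1; ext ω; simp
    · intro j _ j' _ hjj
      refine Set.disjoint_left.2 ?_
      rintro ω ⟨h, _⟩ ⟨h', _⟩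
      exact hjj (h.symm.trans h')
    · intro j _; exact (hf j).inter (hg i)
  have e1 : ∀ i j, (fun ω => (f ω, g ω)) ⁻¹' {(i, j)} = f ⁻¹' {i} ∩ g ⁻¹' {j} := by
    intro i j; ext ω; simp
  unfold shannonEntropy
  rw [Fintype.sum_prod_type]
  simp_rw [e1, ← Measure.real_def, Real.logb]
  have a1 : ∑ i, P.real (f ⁻¹' {i}) * (Real.log (P.real (f ⁻¹' {i})) / Real.log 2)
      = ∑ i, ∑ j, P.real (f ⁻¹' {i} ∩ g ⁻¹' {j}) * (Real.log (P.real (f ⁻¹' {i})) / Real.log 2) := by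
    refine Finset.sum_congr rfl fun i _ => ?_
    rw [← Finset.sum_mul, ← m1]
  have a2 : ∑ i, P.real (g ⁻¹' {i}) * (Real.log (P.real (g ⁻¹' {i})) / Real.log 2)
      = ∑ i, ∑ j, P.real (f ⁻¹' {i} ∩ g ⁻¹' {j}) * (Real.log (P.real (g ⁻¹' {j})) / Real.log 2) := by
    rw [Finset.sum_comm]
    refine Finset.sum_congr rfl fun i _ => ?_
    rw [← Finset.sum_mul, ← m2]
  rw [a1, a2, Finset.sum_div, ← sub_eq_zero]
  simp only [← Finset.sum_neg_distrib, ← Finset.sum_add_distrib, ← Finset.sum_sub_distrib,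
    Finset.sum_div]
  refine Finset.sum_eq_zero fun i _ => Finset.sum_eq_zero fun j _ => ?_
  by_cases h : P.real (f ⁻¹' {i} ∩ g ⁻¹' {j}) = 0
  · simp [h]
  have h1 : P.real (f ⁻¹' {i}) ≠ 0 := fun h' => h
    (le_antisymm (h' ▸ measureReal_mono inter_subset_left) measureReal_nonneg)
  have h2 : P.real (g ⁻¹' {j}) ≠ 0 := fun h' => h
    (le_antisymm (h' ▸ measureReal_mono inter_subset_right) measureReal_nonneg)
  rw [Real.log_div h (mul_ne_zero h1 h2), Real.log_mul h1 h2]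
  ring

lemma rd_integral_fin {X A : Type*} [MeasurableSpace X] [Fintype A] (μ : Measure X)
    [IsFiniteMeasure μ] (α : X → A) (hα : ∀ a, MeasurableSet (α ⁻¹' {a})) (g : A → ℝ) :
    Integrable (fun x => g (α x)) μ ∧
    ∫ x, g (α x) ∂μ = ∑ a, μ.real (α ⁻¹' {a}) * g a := by
  let _ : MeasurableSpace A := ⊤
  have hm : Measurable α := measurable_to_countable' hα
  have hg : Measurable g := measurable_from_top
  have hi : Integrable g (μ.map α) := by
    exact Integrable.of_finite
  refine ⟨hi.comp_measurable hm, ?_⟩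
  rw [← integral_map (f := g) hm.aemeasurable hg.aestronglyMeasurable, integral_fintype hi]
  refine Finset.sum_congr rfl fun a _ => ?_
  rw [map_measureReal_apply hm (measurableSet_singleton a), smul_eq_mul]

end FiniteLemmas

section Codes

/-- data processing for finite codes -/
lemma rd_dpi {A B I K : Type*} [Fintype A] [Fintype B] [Fintype I] [Fintype K] [DecidableEq K]
    (s : I → A → ℝ) (hs : ∀ i a, 0 ≤ s i a) (hs1 : ∑ i, ∑ a, s i a = 1)
    (W : A → B → ℝ) (hW : ∀ a b, 0 ≤ W a b) (hW1 : ∀ a, ∑ b, W a b = 1)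
    (ρ : B → ℝ) (hρ : ∀ b, 0 ≤ ρ b) (hρ1 : ∑ b, ρ b = 1) (hac : ∀ a b, ρ b = 0 → W a b = 0)
    (f : B → K) (r : I → K → ℝ) (r1 : I → ℝ) (r2 : K → ℝ)
    (hr : ∀ i j, r i j = ∑ x : A × B with f x.2 = j, s i x.1 * W x.1 x.2)
    (hr1 : ∀ i, r1 i = ∑ a, s i a) (hr2 : ∀ j, r2 j = ∑ i, r i j) :
    ∑ i, ∑ j, r i j * Real.log (r i j / (r1 i * r2 j))
      ≤ ∑ a, (∑ i, s i a) * ∑ b, W a b * Real.log (W a b / ρ b) := by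
  set ρ' : K → ℝ := fun j => ∑ b with f b = j, ρ b with hρ'
  have hρ'0 : ∀ j, 0 ≤ ρ' j := fun j => Finset.sum_nonneg fun b _ => hρ b
  have hρ'1 : ∑ j, ρ' j = 1 := by
    rw [hρ', Finset.sum_fiberwise, hρ1]
  have hr0 : ∀ i j, 0 ≤ r i j := fun i j => by
    rw [hr]; exact Finset.sum_nonneg fun x _ => mul_nonneg (hs _ _) (hW _ _)
  have hr20 : ∀ j, 0 ≤ r2 j := fun j => by
    rw [hr2]; exact Finset.sum_nonneg fun x _ => hr0 _ _
  have hr10 : ∀ j, 0 ≤ r1 j := fun j => by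
    rw [hr1]; exact Finset.sum_nonneg fun x _ => hs _ _
  have hrr1 : ∀ i, ∑ j, r i j = r1 i := by
    intro i
    simp_rw [hr, hr1]
    rw [Finset.sum_fiberwise, Fintype.sum_prod_type]
    simp_rw [← Finset.mul_sum, hW1, mul_one]
  have hr21 : ∑ j, r2 j = 1 := by
    simp_rw [hr2]
    rw [Finset.sum_comm]
    simp_rw [hrr1, hr1]
    exact hs1
  have hprod : ∀ i j, ∑ x : A × B with f x.2 = j, s i x.1 * ρ x.2 = r1 i * ρ' j := by
    intro i j
    rw [Finset.sum_filter, Fintype.sum_prod_type, hr1, Finset.sum_mul]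
    refine Finset.sum_congr rfl fun a _ => ?_
    rw [hρ', Finset.mul_sum, Finset.sum_filter]
  have hacr : ∀ i j, ρ' j = 0 → r i j = 0 := by
    intro i j h
    have h0 := (Finset.sum_eq_zero_iff_of_nonneg fun b _ => hρ b).1 h
    rw [hr]
    refine Finset.sum_eq_zero fun x hx => ?_
    rw [hac _ _ (h0 x.2 (by simpa using hx)), mul_zero]
  have hac2 : ∀ j, ρ' j = 0 → r2 j = 0 := by
    intro j h
    rw [hr2]; exact Finset.sum_eq_zero fun i _ => hacr i j h
  have step1 : ∑ i, ∑ j, r i j * Real.log (r i j / (r1 i * r2 j)) + ∑ j, r2 j * Real.log (r2 j / ρ' j)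
      = ∑ i, ∑ j, r i j * Real.log (r i j / (r1 i * ρ' j)) := by
    have : ∑ j, r2 j * Real.log (r2 j / ρ' j) = ∑ i, ∑ j, r i j * Real.log (r2 j / ρ' j) := by
      rw [Finset.sum_comm]
      refine Finset.sum_congr rfl fun j _ => ?_
      rw [← Finset.sum_mul, ← hr2]
    rw [this]
    simp_rw [← Finset.sum_add_distrib]
    refine Finset.sum_congr rfl fun i _ => Finset.sum_congr rfl fun j _ => ?_
    by_cases h : r i j = 0
    · simp [h]
    have h1 : r1 i ≠ 0 := by
      intro h'
      rw [← hrr1] at h'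
      exact h ((Finset.sum_eq_zero_iff_of_nonneg fun j _ => hr0 i j).1 h' j (Finset.mem_univ j))
    have h2 : r2 j ≠ 0 := by
      intro h'
      rw [hr2] at h'
      exact h ((Finset.sum_eq_zero_iff_of_nonneg fun i _ => hr0 i j).1 h' i (Finset.mem_univ i))
    have h3 : ρ' j ≠ 0 := fun h' => h (hacr i j h')
    rw [Real.log_div h (mul_ne_zero h1 h2), Real.log_div h (mul_ne_zero h1 h3),
      Real.log_mul h1 h2, Real.log_mul h1 h3, Real.log_div h2 h3]
    ring
  have step2 : 0 ≤ ∑ j, r2 j * Real.log (r2 j / ρ' j) := by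
    have := rd_log_sum Finset.univ r2 ρ' (fun j _ => hr20 j) (fun j _ => hρ'0 j) (fun j _ => hac2 j)
    rw [hr21, hρ'1] at this
    simpa using this
  have step3 : ∀ i j, r i j * Real.log (r i j / (r1 i * ρ' j))
      ≤ ∑ x : A × B with f x.2 = j, s i x.1 * (W x.1 x.2 * Real.log (W x.1 x.2 / ρ x.2)) := by
    intro i j
    have := rd_log_sum (Finset.univ.filter fun x : A × B => f x.2 = j)
      (fun x => s i x.1 * W x.1 x.2) (fun x => s i x.1 * ρ x.2)
      (fun x _ => mul_nonneg (hs _ _) (hW _ _)) (fun x _ => mul_nonneg (hs _ _) (hρ _))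
      (by
        intro x _ h
        rcases mul_eq_zero.1 h with h | h
        · simp [h]
        · simp [hac x.1 _ h])
    rw [hprod, ← hr] at this
    refine this.trans (le_of_eq (Finset.sum_congr rfl fun x _ => ?_))
    by_cases h : s i x.1 = 0
    · simp [h]
    · rw [mul_div_mul_left _ _ h, mul_assoc]
  calc ∑ i, ∑ j, r i j * Real.log (r i j / (r1 i * r2 j))
      ≤ ∑ i, ∑ j, r i j * Real.log (r i j / (r1 i * ρ' j)) := by linarith
    _ ≤ ∑ i, ∑ j, ∑ x : A × B with f x.2 = j,
          s i x.1 * (W x.1 x.2 * Real.log (W x.1 x.2 / ρ x.2)) :=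
        Finset.sum_le_sum fun i _ => Finset.sum_le_sum fun j _ => step3 i j
    _ = ∑ a, (∑ i, s i a) * ∑ b, W a b * Real.log (W a b / ρ b) := by
        simp_rw [Finset.sum_fiberwise, Fintype.sum_prod_type, ← Finset.mul_sum]
        rw [Finset.sum_comm]
        simp_rw [← Finset.sum_mul]

/-- The unnormalized distortion between an orbit and a map on the box. -/
noncomputable def rdD {X : Type*} [MetricSpace X] (d : ℕ) (T : (Fin d → ℝ) → X → X) (L : ℝ)
    (x : X) (y : L1Maps d L X) : ℝ :=
  ∫ u, dist (T u x) (y u) ∂(boxMeasure d L)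

/-- A finite code: a finite partition of `X`, a stochastic matrix, a reference law
and reproduction points. -/
structure RDCode {X : Type*} [MetricSpace X] [MeasurableSpace X] (d : ℕ)
    (T : (Fin d → ℝ) → X → X) (L : ℝ) where
  A : Type
  B : Type
  fA : Fintype A
  fB : Fintype B
  α : X → A
  W : A → B → ℝ
  ρ : B → ℝ
  y : B → L1Maps d L X
  c : A → B → ℝ
  hα : ∀ a, MeasurableSet (α ⁻¹' {a})
  hW : ∀ a b, 0 ≤ W a b
  hW1 : ∀ a, ∑ b, W a b = 1
  hρ : ∀ b, 0 ≤ ρ b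
  hρ1 : ∑ b, ρ b = 1
  hac : ∀ a b, ρ b = 0 → W a b = 0
  hc : ∀ x b, rdD d T L x (y b) ≤ c (α x) b

attribute [instance] RDCode.fA RDCode.fB

/-- distortion bound of a code -/
noncomputable def RDCode.dis {X : Type*} [MetricSpace X] [MeasurableSpace X] {d : ℕ}
    {T : (Fin d → ℝ) → X → X} {L : ℝ} (C : RDCode d T L) (μ : Measure X) : ℝ :=
  ∫ x, ∑ b, C.W (C.α x) b * C.c (C.α x) b ∂μ

/-- rate bound of a code -/
noncomputable def RDCode.cost {X : Type*} [MetricSpace X] [MeasurableSpace X] {d : ℕ}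
    {T : (Fin d → ℝ) → X → X} {L : ℝ} (C : RDCode d T L) (μ : Measure X) : ℝ :=
  ∫ x, ∑ b, C.W (C.α x) b * Real.log (C.W (C.α x) b / C.ρ b) ∂μ

lemma rd_exists_base {X : Type*} [MetricSpace X] [CompactSpace X] [MeasurableSpace X] [BorelSpace X]
    (μ : Measure X) [IsProbabilityMeasure μ] :
    ∃ (ν : Measure ℝ) (Z : ℝ → X), Measurable Z ∧ ν.map Z = μ := by
  have : Nonempty X := nonempty_of_isProbabilityMeasure μ
  have he := MeasureTheory.measurableEmbedding_embeddingReal X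
  refine ⟨μ.map (embeddingReal X), he.invFun, he.measurable_invFun, ?_⟩
  rw [Measure.map_map he.measurable_invFun he.measurable]
  have : he.invFun ∘ embeddingReal X = id := funext fun x => he.leftInverse_invFun x
  rw [this, Measure.map_id]

lemma rd_code_le {X : Type*} [MetricSpace X] [CompactSpace X] [MeasurableSpace X] [BorelSpace X]
    (d : ℕ) (T : (Fin d → ℝ) → X → X) (μ : Measure X) [IsProbabilityMeasure μ] (L ε : ℝ)
    (hL : 0 < L) (C : RDCode d T L) (h : C.dis μ < ε * L ^ d) :
    RL d T μ L ε ≤ ENNReal.ofReal (C.cost μ / Real.log 2) := by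
  classical
  obtain ⟨ν, Z, hZ, hZμ⟩ := rd_exists_base μ
  obtain ⟨A, B, fA, fB, α, W, ρ, y, c, hα, hW, hW1, hρ, hρ1, hac, hc⟩ := C
  simp only [RDCode.dis, RDCode.cost] at h ⊢
  let mB : MeasurableSpace B := ⊤
  have hνf : IsProbabilityMeasure ν := by
    refine ⟨?_⟩
    have : (ν.map Z) univ = 1 := by rw [hZμ]; simp
    rwa [Measure.map_apply hZ MeasurableSet.univ, preimage_univ] at this
  set P : Measure (ℝ × B) := ∑ a, ∑ b, ENNReal.ofReal (W a b) •
    ((ν.restrict (Z ⁻¹' (α ⁻¹' {a}))).map (fun ω => (ω, b))) with hP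
  have hPapp : ∀ (E : Set X) (hE : MeasurableSet E) (F : Set B),
      P ((fun ω => Z ω.1) ⁻¹' E ∩ Prod.snd ⁻¹' F)
        = ∑ x : A × B with x.2 ∈ F, ENNReal.ofReal (W x.1 x.2) * μ (E ∩ α ⁻¹' {x.1}) := by
    intro E hE F
    have hmE : MeasurableSet ((fun ω : ℝ × B => Z ω.1) ⁻¹' E ∩ Prod.snd ⁻¹' F) :=
      ((hZ.comp measurable_fst) hE).inter (measurable_snd (MeasurableSpace.measurableSet_top))
    rw [hP, Finset.sum_filter, Fintype.sum_prod_type]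
    simp only [Measure.coe_finsetSum, Finset.sum_apply, Measure.smul_apply, smul_eq_mul]
    refine Finset.sum_congr rfl fun a _ => Finset.sum_congr rfl fun b _ => ?_
    rw [Measure.map_apply (by fun_prop) hmE, Measure.restrict_apply (by exact (measurable_id.prodMk measurable_const) hmE)]
    split_ifs with hb
    · rw [← hZμ, Measure.map_apply hZ (hE.inter (hα a))]
      congr 2
      ext ω; simp [hb]
    · have : (fun ω : ℝ => (ω, b)) ⁻¹' ((fun ω => Z ω.1) ⁻¹' E ∩ Prod.snd ⁻¹' F) = ∅ := by
        ext ω; simp [hb]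
      rw [this]; simp
  have hPtot : ∀ (E : Set X) (hE : MeasurableSet E),
      P ((fun ω => Z ω.1) ⁻¹' E) = μ E := by
    intro E hE
    have := hPapp E hE univ
    rw [preimage_univ, inter_univ] at this
    rw [this]
    simp only [mem_univ, Finset.filter_true, Fintype.sum_prod_type]
    simp_rw [← Finset.sum_mul]
    have h1 : ∀ a, ∑ b, ENNReal.ofReal (W a b) = 1 := by
      intro a
      rw [← ENNReal.ofReal_sum_of_nonneg fun b _ => hW a b, hW1, ENNReal.ofReal_one]
    simp_rw [h1, one_mul]
    rw [← measure_biUnion_finset]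
    · congr 1; ext x; simp
    · intro j _ j' _ hjj
      refine Set.disjoint_left.2 ?_
      rintro ω ⟨_, h⟩ ⟨_, h'⟩
      exact hjj (h.symm.trans h')
    · intro a _; exact hE.inter (hα a)
  have hPprob : IsProbabilityMeasure P := by
    refine ⟨?_⟩
    have := hPtot univ MeasurableSet.univ
    rw [preimage_univ] at this
    rw [this]; simp
  have hPreal : ∀ (E : Set X) (hE : MeasurableSet E) (F : Set B),
      P.real ((fun ω => Z ω.1) ⁻¹' E ∩ Prod.snd ⁻¹' F)
        = ∑ x : A × B with x.2 ∈ F, μ.real (E ∩ α ⁻¹' {x.1}) * W x.1 x.2 := by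
    intro E hE F
    rw [measureReal_def, hPapp E hE F, ENNReal.toReal_sum]
    · refine Finset.sum_congr rfl fun x _ => ?_
      rw [ENNReal.toReal_mul, ENNReal.toReal_ofReal (hW _ _), mul_comm, measureReal_def]
    · intro x _
      exact ENNReal.mul_ne_top ENNReal.ofReal_ne_top (measure_ne_top _ _)
  have hXm : Measurable (fun ω : ℝ × B => Z ω.1) := hZ.comp measurable_fst
  have hYm : Measurable (fun ω : ℝ × B => y ω.2) :=
    (measurable_from_top (f := y)).comp measurable_snd
  have hlaw : Measure.map (fun ω : ℝ × B => Z ω.1) P = μ := by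
    ext E hE
    rw [Measure.map_apply hXm hE, hPtot E hE]
  have hLd : 0 < L ^ d := pow_pos hL d
  have hdis : distortion d T L P (fun ω : ℝ × B => Z ω.1) (fun ω : ℝ × B => y ω.2) < ε := by
    unfold distortion
    rw [integral_const_mul, inv_mul_lt_iff₀ hLd, mul_comm]
    refine lt_of_le_of_lt ?_ h
    have hg := rd_integral_fin P (fun ω : ℝ × B => (α (Z ω.1), ω.2)) (by
      rintro ⟨a, b⟩
      have : (fun ω : ℝ × B => (α (Z ω.1), ω.2)) ⁻¹' {(a, b)}
        = (fun ω => Z ω.1) ⁻¹' (α ⁻¹' {a}) ∩ Prod.snd ⁻¹' {b} := by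
        ext ω; simp
      rw [this]
      exact (hXm (hα a)).inter (measurable_snd (MeasurableSpace.measurableSet_top)))
      (fun x => c x.1 x.2)
    refine (integral_mono_of_nonneg (Eventually.of_forall fun ω => integral_nonneg fun u => dist_nonneg)
      hg.1 (Eventually.of_forall fun ω => hc (Z ω.1) ω.2)).trans ?_
    rw [hg.2, (rd_integral_fin μ α hα (fun a => ∑ b, W a b * c a b)).2, Fintype.sum_prod_type]
    refine le_of_eq (Finset.sum_congr rfl fun a _ => ?_)
    rw [Finset.mul_sum]
    refine Finset.sum_congr rfl fun b _ => ?_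
    have : (fun ω : ℝ × B => (α (Z ω.1), ω.2)) ⁻¹' {(a, b)}
        = (fun ω => Z ω.1) ⁻¹' (α ⁻¹' {a}) ∩ Prod.snd ⁻¹' {b} := by
        ext ω; simp
    rw [this, hPreal _ (hα a), Finset.sum_eq_single (a, b)]
    · simp only [inter_self]; ring
    · rintro ⟨a', b'⟩ hx hne
      have hb : b' = b := by simpa using hx
      have ha : a' ≠ a := fun h => hne (by rw [h, hb])
      have : α ⁻¹' {a} ∩ α ⁻¹' {a'} = ∅ := by
        ext x; simp only [mem_inter_iff, mem_preimage, mem_singleton_iff, mem_empty_iff_false, iff_false]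
        rintro ⟨h1, h2⟩; exact ha (h2.symm.trans h1)
      rw [this]; simp
    · intro hn; simp at hn
  have hmi : mutualInfo P (fun ω : ℝ × B => Z ω.1) (fun ω : ℝ × B => y ω.2)
      ≤ ENNReal.ofReal ((∫ x, ∑ b, W (α x) b * Real.log (W (α x) b / ρ b) ∂μ) / Real.log 2) := by
    unfold mutualInfo
    refine iSup_le fun n => iSup_le fun m => iSup_le fun α' => iSup_le fun hα' => iSup_le fun β' =>
      iSup_le fun hβ' => ?_
    refine ENNReal.ofReal_le_ofReal ?_
    rw [rd_mi_eq P (fun ω : ℝ × B => α' (Z ω.1)) (fun ω : ℝ × B => β' (y ω.2))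
      (fun i => (hα'.comp hXm) (measurableSet_singleton i))
      (fun i => (hβ'.comp hYm) (measurableSet_singleton i))]
    refine div_le_div_of_nonneg_right ?_ (Real.log_nonneg (by norm_num))
    have hs2 : ∀ E : Set X, MeasurableSet E → μ.real E = ∑ a, μ.real (E ∩ α ⁻¹' {a}) := by
      intro E hE
      rw [← measureReal_biUnion_finset]
      · congr 1; ext x; simp
      · intro j _ j' _ hjj
        refine Set.disjoint_left.2 ?_
        rintro ω ⟨_, h⟩ ⟨_, h'⟩
        exact hjj (h.symm.trans h')
      · intro a _; exact hE.inter (hα a)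
    have hs3 : ∀ a, μ.real (α ⁻¹' {a}) = ∑ i, μ.real (α' ⁻¹' {i} ∩ α ⁻¹' {a}) := by
      intro a
      rw [← measureReal_biUnion_finset]
      · congr 1; ext x; simp
      · intro j _ j' _ hjj
        refine Set.disjoint_left.2 ?_
        rintro ω ⟨h, _⟩ ⟨h', _⟩
        exact hjj (h.symm.trans h')
      · intro i _; exact (hα' (measurableSet_singleton i)).inter (hα a)
    have hr2 : ∀ j, P.real ((fun ω : ℝ × B => β' (y ω.2)) ⁻¹' {j})
        = ∑ i, P.real ((fun ω : ℝ × B => α' (Z ω.1)) ⁻¹' {i} ∩ (fun ω : ℝ × B => β' (y ω.2)) ⁻¹' {j}) := by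
      intro j
      rw [← measureReal_biUnion_finset]
      · congr 1; ext x; simp
      · intro j _ j' _ hjj
        refine Set.disjoint_left.2 ?_
        rintro ω ⟨h, _⟩ ⟨h', _⟩
        exact hjj (h.symm.trans h')
      · intro i _
        exact ((hα'.comp hXm) (measurableSet_singleton i)).inter
          ((hβ'.comp hYm) (measurableSet_singleton j))
    have := rd_dpi (fun i a => μ.real (α' ⁻¹' {i} ∩ α ⁻¹' {a})) (fun _ _ => measureReal_nonneg)
      (by
        rw [Finset.sum_comm]
        simp_rw [← hs3]
        have := hs2 univ MeasurableSet.univ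
        simpa using this.symm)
      W hW hW1 ρ hρ hρ1 hac (fun b => β' (y b))
      (fun i j => P.real ((fun ω : ℝ × B => α' (Z ω.1)) ⁻¹' {i} ∩ (fun ω : ℝ × B => β' (y ω.2)) ⁻¹' {j}))
      (fun i => P.real ((fun ω : ℝ × B => α' (Z ω.1)) ⁻¹' {i}))
      (fun j => P.real ((fun ω : ℝ × B => β' (y ω.2)) ⁻¹' {j}))
      (by
        intro i j
        exact (hPreal (α' ⁻¹' {i}) (hα' (measurableSet_singleton i)) {b | β' (y b) = j}).trans
          (Finset.sum_congr (by ext x; simp) fun _ _ => rfl))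
      (by
        intro i
        rw [← hs2 _ (hα' (measurableSet_singleton i)), measureReal_def, measureReal_def]
        exact congrArg _ (hPtot (α' ⁻¹' {i}) (hα' (measurableSet_singleton i))))
      hr2
    refine this.trans (le_of_eq ?_)
    rw [(rd_integral_fin μ α hα (fun a => ∑ b, W a b * Real.log (W a b / ρ b))).2]
    simp_rw [hs3]
  refine le_trans ?_ hmi
  unfold RL
  exact iInf_le_of_le (ℝ × B) <| iInf_le_of_le inferInstance <| iInf_le_of_le P <|
    iInf_le_of_le hPprob <| iInf_le_of_le (fun ω => Z ω.1) <| iInf_le_of_le (fun ω => y ω.2) <|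
    iInf_le_of_le hXm <| iInf_le_of_le hYm <| iInf_le_of_le hlaw <| iInf_le_of_le hdis le_rfl

end Codes

section Topo

set_option linter.unusedSectionVars false

lemma rd_box_univ (d : ℕ) (L : ℝ) : (boxMeasure d L) univ = ENNReal.ofReal L ^ d := by
  rw [boxMeasure, Measure.restrict_apply_univ, unitBox, volume_pi_pi]
  simp

instance rd_box_finite (d : ℕ) (L : ℝ) : IsFiniteMeasure (boxMeasure d L) :=
  ⟨by rw [rd_box_univ]; exact ENNReal.pow_lt_top ENNReal.ofReal_lt_top⟩

lemma rd_box_real (d : ℕ) (L : ℝ) (hL : 0 ≤ L) : (boxMeasure d L).real univ = L ^ d := by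
  rw [measureReal_def, rd_box_univ, ENNReal.toReal_pow, ENNReal.toReal_ofReal hL]

variable {X : Type*} [MetricSpace X] [CompactSpace X] [MeasurableSpace X] [BorelSpace X]

lemma rd_dist_le (x y : X) : dist x y ≤ Metric.diam (univ : Set X) :=
  Metric.dist_le_diam_of_mem isCompact_univ.isBounded (mem_univ x) (mem_univ y)

lemma rd_integrable {Ω : Type*} [MeasurableSpace Ω] (m : Measure Ω) [IsFiniteMeasure m]
    (f g : Ω → X) (hf : AEStronglyMeasurable f m) (hg : AEStronglyMeasurable g m) :
    Integrable (fun u => dist (f u) (g u)) m := by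
  refine Integrable.of_bound (hf.dist hg) (Metric.diam (univ : Set X)) ?_
  exact Eventually.of_forall fun u => by
    rw [Real.norm_of_nonneg dist_nonneg]; exact rd_dist_le _ _

lemma rd_orb_cont {d : ℕ} {T : (Fin d → ℝ) → X → X} (hT : IsContAction d T) (x : X) :
    Continuous fun u => T u x := hT.1.comp (by fun_prop : Continuous fun u => (u, x))

lemma rd_orb_cont' {d : ℕ} {T : (Fin d → ℝ) → X → X} (hT : IsContAction d T) (u : Fin d → ℝ) :
    Continuous fun x => T u x := hT.1.comp (by fun_prop : Continuous fun x => (u, x))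

/-- the orbit as an element of `L¹` -/
noncomputable def rdOrb {d : ℕ} {T : (Fin d → ℝ) → X → X} (hT : IsContAction d T) (L : ℝ) (x : X) :
    L1Maps d L X :=
  AEEqFun.mk (fun u => T u x) (rd_orb_cont hT x).aestronglyMeasurable

lemma rdOrb_coe {d : ℕ} {T : (Fin d → ℝ) → X → X} (hT : IsContAction d T) (L : ℝ) (x : X) :
    ∀ᵐ u ∂(boxMeasure d L), rdOrb hT L x u = T u x := AEEqFun.coeFn_mk _ _

lemma rd_D_eq {d : ℕ} {T : (Fin d → ℝ) → X → X} (hT : IsContAction d T) (L : ℝ) (x : X)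
    (y : L1Maps d L X) : rdD d T L x y = L1dist (rdOrb hT L x) y := by
  unfold rdD L1dist
  refine integral_congr_ae ?_
  filter_upwards [rdOrb_coe hT L x] with u hu
  rw [hu]

lemma rd_D_meas {d : ℕ} {T : (Fin d → ℝ) → X → X} (hT : IsContAction d T) (L : ℝ) (x : X) :
    Measurable fun y : L1Maps d L X => rdD d T L x y := by
  simp_rw [rd_D_eq hT]
  refine measurable_of_Iio fun r => ?_
  exact MeasurableSpace.measurableSet_generateFrom ⟨rdOrb hT L x, r, rfl⟩

lemma rd_D_cont {d : ℕ} {T : (Fin d → ℝ) → X → X} (hT : IsContAction d T) (L : ℝ)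
    (y : L1Maps d L X) : Continuous fun x => rdD d T L x y := by
  unfold rdD
  refine continuous_of_dominated (bound := fun _ => Metric.diam (univ : Set X)) ?_ ?_ ?_ ?_
  · intro x
    exact (rd_orb_cont hT x).aestronglyMeasurable.dist y.stronglyMeasurable.aestronglyMeasurable
  · intro x
    exact Eventually.of_forall fun u => by
      rw [Real.norm_of_nonneg dist_nonneg]; exact rd_dist_le _ _
  · exact integrable_const _
  · exact Eventually.of_forall fun u => (rd_orb_cont' hT u).dist continuous_const

lemma rd_D_nonneg {d : ℕ} {T : (Fin d → ℝ) → X → X} (L : ℝ) (x : X)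
    (y : L1Maps d L X) : 0 ≤ rdD d T L x y := integral_nonneg fun _ => dist_nonneg

lemma rd_D_le {d : ℕ} {T : (Fin d → ℝ) → X → X} {L : ℝ} (hL : 0 ≤ L) (x : X)
    (y : L1Maps d L X) : rdD d T L x y ≤ Metric.diam (univ : Set X) * L ^ d := by
  have := integral_mono_of_nonneg (μ := boxMeasure d L) (f := fun u => dist (T u x) (y u))
    (g := fun _ => Metric.diam (univ : Set X)) (Eventually.of_forall fun _ => dist_nonneg)
    (integrable_const _) (Eventually.of_forall fun _ => rd_dist_le _ _)
  rw [integral_const, rd_box_real d L hL, smul_eq_mul, mul_comm] at this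
  exact this

lemma rd_D_tri {d : ℕ} {T : (Fin d → ℝ) → X → X} (hT : IsContAction d T) (L : ℝ) (x x' : X)
    (y : L1Maps d L X) : rdD d T L x y ≤ rdD d T L x (rdOrb hT L x') + rdD d T L x' y := by
  have h1 : Integrable (fun u => dist (T u x) (rdOrb hT L x' u)) (boxMeasure d L) :=
    rd_integrable _ _ _ (rd_orb_cont hT x).aestronglyMeasurable
      (AEEqFun.stronglyMeasurable _).aestronglyMeasurable
  have h2 : Integrable (fun u => dist (T u x') (y u)) (boxMeasure d L) :=
    rd_integrable _ _ _ (rd_orb_cont hT x').aestronglyMeasurable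
      (AEEqFun.stronglyMeasurable _).aestronglyMeasurable
  unfold rdD
  rw [← integral_add h1 h2]
  refine integral_mono_ae (rd_integrable _ _ _ (rd_orb_cont hT x).aestronglyMeasurable
      (AEEqFun.stronglyMeasurable _).aestronglyMeasurable) (h1.add h2) ?_
  filter_upwards [rdOrb_coe hT L x'] with u hu
  rw [hu]
  exact dist_triangle _ _ _

lemma rd_F_self {d : ℕ} {T : (Fin d → ℝ) → X → X} (hT : IsContAction d T) (L : ℝ) (x : X) :
    rdD d T L x (rdOrb hT L x) = 0 := by
  unfold rdD
  rw [integral_congr_ae (g := fun _ => (0 : ℝ))]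
  · simp
  · filter_upwards [rdOrb_coe hT L x] with u hu
    rw [hu, dist_self]

lemma rd_F_symm {d : ℕ} {T : (Fin d → ℝ) → X → X} (hT : IsContAction d T) (L : ℝ) (x x' : X) :
    rdD d T L x (rdOrb hT L x') = rdD d T L x' (rdOrb hT L x) := by
  unfold rdD
  refine integral_congr_ae ?_
  filter_upwards [rdOrb_coe hT L x, rdOrb_coe hT L x'] with u hu hu'
  rw [hu, hu', dist_comm]

/-- fine finite partitions -/
lemma rd_partition {d : ℕ} {T : (Fin d → ℝ) → X → X} (hT : IsContAction d T) (L δ : ℝ)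
    (hδ : 0 < δ) [Nonempty X] : ∃ (n : ℕ) (α : X → Fin n) (z : Fin n → X), Measurable α ∧
      ∀ x, rdD d T L x (rdOrb hT L (z (α x))) ≤ δ := by
  classical
  obtain ⟨t, ht⟩ := isCompact_univ.elim_finite_subcover
    (fun z : X => {x | rdD d T L x (rdOrb hT L z) < δ / 2})
    (fun z => isOpen_lt (rd_D_cont hT L _) continuous_const)
    (fun x _ => mem_iUnion.2 ⟨x, by simp only [mem_ofPred_eq, rd_F_self]; positivity⟩)
  let A := t → Bool
  let α : X → A := fun x z => decide (rdD d T L x (rdOrb hT L z.1) < δ / 2)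
  have hα : ∀ a, MeasurableSet (α ⁻¹' {a}) := by
    intro a
    have : α ⁻¹' {a} = ⋂ z : t, {x | decide (rdD d T L x (rdOrb hT L z.1) < δ / 2) = a z} := by
      ext x
      rw [mem_preimage, mem_singleton_iff, funext_iff, mem_iInter]
      rfl
    rw [this]
    refine MeasurableSet.iInter fun z => ?_
    have hm : MeasurableSet {x | rdD d T L x (rdOrb hT L z.1) < δ / 2} :=
      (isOpen_lt (rd_D_cont hT L _) continuous_const).measurableSet
    cases a z
    · simpa [Set.compl_def] using hm.compl
    · simpa using hm
  let z : A → X := fun a => if h : ∃ x, α x = a then h.choose else Classical.arbitrary X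
  let e := Fintype.equivFin A
  refine ⟨Fintype.card A, fun x => e (α x), fun i => z (e.symm i), ?_, ?_⟩
  · refine measurable_to_countable' fun i => ?_
    have : (fun x => e (α x)) ⁻¹' {i} = α ⁻¹' {e.symm i} := by
      ext x; simp [Equiv.eq_symm_apply]
    rw [this]; exact hα _
  · intro x
    simp only [Equiv.symm_apply_apply]
    have hex : ∃ x', α x' = α x := ⟨x, rfl⟩
    have hz : α (z (α x)) = α x := by
      simp only [z, dif_pos hex]
      exact hex.choose_spec
    set x' := z (α x)
    obtain ⟨w, hw⟩ := mem_iUnion.1 (ht (mem_univ x))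
    obtain ⟨hwt, hw⟩ := mem_iUnion.1 hw
    have h1 : rdD d T L x (rdOrb hT L w) < δ / 2 := hw
    have h2 : rdD d T L x' (rdOrb hT L w) < δ / 2 := by
      have := congrFun hz ⟨w, hwt⟩
      simp only [α, h1, decide_true, decide_eq_true_eq] at this
      exact this
    have := rd_D_tri hT L x w (rdOrb hT L x')
    rw [rd_F_symm hT L w x'] at this
    linarith

end Topo

section Discretize

set_option linter.unusedSectionVars false

variable {X : Type*} [MetricSpace X] [CompactSpace X] [MeasurableSpace X] [BorelSpace X]

lemma rd_quant {d : ℕ} {T : (Fin d → ℝ) → X → X} (hT : IsContAction d T) (L δ : ℝ) (hL : 0 ≤ L)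
    (hδ : 0 < δ) [Nonempty X] (n : ℕ) (z : Fin n → X) :
    ∃ (m : ℕ) (β : L1Maps d L X → Fin m) (y : Fin m → L1Maps d L X), Measurable β ∧
      ∀ Y i, rdD d T L (z i) (y (β Y)) ≤ rdD d T L (z i) Y + δ := by
  classical
  set M : ℕ := ⌊Metric.diam (univ : Set X) * L ^ d / δ⌋₊ + 1 with hM
  have hlt : ∀ x (Y : L1Maps d L X), ⌊rdD d T L x Y / δ⌋₊ < M := by
    intro x Y
    refine Nat.lt_succ_of_le (Nat.floor_le_floor ?_)
    exact div_le_div_of_nonneg_right (rd_D_le hL x Y) hδ.le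
  let B := Fin n → Fin M
  let β : L1Maps d L X → B := fun Y i => ⟨⌊rdD d T L (z i) Y / δ⌋₊, hlt _ _⟩
  have hβ : ∀ b, MeasurableSet (β ⁻¹' {b}) := by
    intro b
    have : β ⁻¹' {b} = ⋂ i, (fun Y => ⌊rdD d T L (z i) Y / δ⌋₊) ⁻¹' {(b i : ℕ)} := by
      ext Y
      rw [mem_preimage, mem_singleton_iff, funext_iff, mem_iInter]
      refine forall_congr' fun i => ?_
      rw [Fin.ext_iff]; rfl
    rw [this]
    refine MeasurableSet.iInter fun i => ?_
    exact (Nat.measurable_floor.comp ((rd_D_meas hT L (z i)).div_const δ)) (measurableSet_singleton _)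
  let y : B → L1Maps d L X := fun b => if h : ∃ Y, β Y = b then h.choose
    else rdOrb hT L (Classical.arbitrary X)
  let e := Fintype.equivFin B
  refine ⟨Fintype.card B, fun Y => e (β Y), fun i => y (e.symm i), ?_, ?_⟩
  · refine measurable_to_countable' fun i => ?_
    have : (fun x => e (β x)) ⁻¹' {i} = β ⁻¹' {e.symm i} := by
      ext x; simp [Equiv.eq_symm_apply]
    rw [this]; exact hβ _
  · intro Y i
    simp only [Equiv.symm_apply_apply]
    have hex : ∃ Y', β Y' = β Y := ⟨Y, rfl⟩
    have hz : β (y (β Y)) = β Y := by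
      simp only [y, dif_pos hex]
      exact hex.choose_spec
    set Y' := y (β Y)
    have h1 : ⌊rdD d T L (z i) Y' / δ⌋₊ = ⌊rdD d T L (z i) Y / δ⌋₊ := by
      have := congrFun hz i
      rw [Fin.ext_iff] at this
      exact this
    have h2 := Nat.lt_floor_add_one (rdD d T L (z i) Y' / δ)
    have h3 := Nat.floor_le (div_nonneg (rd_D_nonneg (T := T) L (z i) Y) hδ.le)
    rw [h1] at h2
    have h4 : rdD d T L (z i) Y' / δ ≤ rdD d T L (z i) Y / δ + 1 := by linarith
    rw [div_add_one hδ.ne', div_le_div_iff_of_pos_right hδ] at h4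
    exact h4

lemma rd_exists_code {d : ℕ} {T : (Fin d → ℝ) → X → X} (hT : IsContAction d T)
    (μ : Measure X) [IsProbabilityMeasure μ] (L ε : ℝ) (hL : 0 < L) (t : ℝ≥0∞)
    (h : RL d T μ L ε < t) :
    ∃ C : RDCode d T L, C.dis μ < ε * L ^ d ∧ ENNReal.ofReal (C.cost μ / Real.log 2) < t := by
  classical
  have : Nonempty X := nonempty_of_isProbabilityMeasure μ
  unfold RL at h
  simp only [iInf_lt_iff] at h
  obtain ⟨Ω, mΩ, P, hP, Xv, Yv, hX, hY, hlaw, hdis, hmi⟩ := h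
  have hLd : 0 < L ^ d := pow_pos hL d
  set D : Ω → ℝ := fun ω => rdD d T L (Xv ω) (Yv ω) with hD
  have hDm : Measurable D := by
    have := measurable_uncurry_of_continuous_of_measurable
      (u := fun (x : X) (y : L1Maps d L X) => rdD d T L x y)
      (fun y => rd_D_cont hT L y) (fun x => rd_D_meas hT L x)
    exact this.comp (hX.prodMk hY)
  have hDi : Integrable D P := by
    refine Integrable.of_bound hDm.aestronglyMeasurable (Metric.diam (univ : Set X) * L ^ d) ?_
    exact Eventually.of_forall fun ω => by
      rw [Real.norm_of_nonneg (rd_D_nonneg _ _ _)]; exact rd_D_le hL.le _ _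
  have hDint : ∫ ω, D ω ∂P < ε * L ^ d := by
    unfold distortion at hdis
    rw [integral_const_mul, inv_mul_lt_iff₀ hLd, mul_comm] at hdis
    exact hdis
  obtain ⟨δ, hδ, hδ2⟩ : ∃ δ : ℝ, 0 < δ ∧ ∫ ω, D ω ∂P + 3 * δ < ε * L ^ d :=
    ⟨(ε * L ^ d - ∫ ω, D ω ∂P) / 5, by linarith, by linarith⟩
  obtain ⟨n, α, z, hα, hz⟩ := rd_partition hT L δ hδ
  obtain ⟨m, β, y, hβ, hy⟩ := rd_quant hT L δ hL.le hδ n z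
  have hαX : ∀ i, MeasurableSet ((fun ω => α (Xv ω)) ⁻¹' {i}) :=
    fun i => (hα.comp hX) (measurableSet_singleton i)
  have hβY : ∀ i, MeasurableSet ((fun ω => β (Yv ω)) ⁻¹' {i}) :=
    fun i => (hβ.comp hY) (measurableSet_singleton i)
  have hpq : ∀ i, μ.real (α ⁻¹' {i}) = P.real ((fun ω => α (Xv ω)) ⁻¹' {i}) := by
    intro i
    rw [← hlaw, map_measureReal_apply hX (hα (measurableSet_singleton i))]
    rfl
  have hmarg : ∀ i, ∑ j, P.real ((fun ω => α (Xv ω)) ⁻¹' {i} ∩ (fun ω => β (Yv ω)) ⁻¹' {j})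
      = μ.real (α ⁻¹' {i}) := by
    intro i
    rw [hpq, ← measureReal_biUnion_finset]
    · congr 1; ext x; simp
    · intro j _ j' _ hjj
      refine Set.disjoint_left.2 ?_
      rintro ω ⟨_, h⟩ ⟨_, h'⟩
      exact hjj (h.symm.trans h')
    · intro j _; exact (hαX i).inter (hβY j)
  have hρ1 : ∑ j, P.real ((fun ω => β (Yv ω)) ⁻¹' {j}) = 1 := by
    have := (rd_integral_fin P (fun ω => β (Yv ω)) hβY (fun _ => 1)).2
    simpa using this.symm
  obtain ⟨W, hW, hW1, hac, hWq⟩ := rd_disint (fun i => μ.real (α ⁻¹' {i}))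
    (fun i j => P.real ((fun ω => α (Xv ω)) ⁻¹' {i} ∩ (fun ω => β (Yv ω)) ⁻¹' {j}))
    (fun _ _ => measureReal_nonneg) hmarg (fun j => P.real ((fun ω => β (Yv ω)) ⁻¹' {j}))
    (fun _ => measureReal_nonneg) hρ1
    (fun i j h' => le_antisymm (h' ▸ measureReal_mono inter_subset_right) measureReal_nonneg)
  refine ⟨⟨Fin n, Fin m, inferInstance, inferInstance, α, W,
    fun j => P.real ((fun ω => β (Yv ω)) ⁻¹' {j}), y, fun i j => rdD d T L (z i) (y j) + δ,
    fun i => hα (measurableSet_singleton i), hW, hW1, fun _ => measureReal_nonneg, hρ1, hac, ?_⟩,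
    ?_, ?_⟩
  · intro x b
    have := rd_D_tri hT L x (z (α x)) (y b)
    linarith [hz x]
  · refine lt_of_le_of_lt ?_ hδ2
    simp only [RDCode.dis]
    rw [(rd_integral_fin μ α (fun i => hα (measurableSet_singleton i))
      (fun a => ∑ b, W a b * (rdD d T L (z a) (y b) + δ))).2]
    have hg := rd_integral_fin P (fun ω => (α (Xv ω), β (Yv ω))) (by
      rintro ⟨a, b⟩
      have : (fun ω => (α (Xv ω), β (Yv ω))) ⁻¹' {(a, b)}
        = (fun ω => α (Xv ω)) ⁻¹' {a} ∩ (fun ω => β (Yv ω)) ⁻¹' {b} := by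
        ext ω; simp
      rw [this]
      exact (hαX a).inter (hβY b))
      (fun x => rdD d T L (z x.1) (y x.2) + δ)
    have e1 : ∑ a, μ.real (α ⁻¹' {a}) * ∑ b, W a b * (rdD d T L (z a) (y b) + δ)
        = ∫ ω, (rdD d T L (z (α (Xv ω))) (y (β (Yv ω))) + δ) ∂P := by
      rw [hg.2, Fintype.sum_prod_type]
      refine Finset.sum_congr rfl fun a _ => ?_
      rw [Finset.mul_sum]
      refine Finset.sum_congr rfl fun b _ => ?_
      have : (fun ω => (α (Xv ω), β (Yv ω))) ⁻¹' {(a, b)}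
        = (fun ω => α (Xv ω)) ⁻¹' {a} ∩ (fun ω => β (Yv ω)) ⁻¹' {b} := by
        ext ω; simp
      rw [this, ← mul_assoc, hWq]
    rw [e1]
    have e2 : ∫ ω, D ω ∂P + 3 * δ = ∫ ω, (D ω + 3 * δ) ∂P := by
      rw [integral_add hDi (integrable_const _)]; simp
    rw [e2]
    refine integral_mono hg.1 (hDi.add (integrable_const _)) fun ω => ?_
    have a1 := hy (Yv ω) (α (Xv ω))
    have a2 := rd_D_tri hT L (z (α (Xv ω))) (Xv ω) (Yv ω)
    have a3 := hz (Xv ω)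
    rw [rd_F_symm] at a3
    simp only [hD]
    linarith
  · refine lt_of_le_of_lt ?_ hmi
    simp only [RDCode.cost]
    rw [(rd_integral_fin μ α (fun i => hα (measurableSet_singleton i))
      (fun a => ∑ b, W a b * Real.log (W a b / P.real ((fun ω => β (Yv ω)) ⁻¹' {b})))).2]
    unfold mutualInfo
    refine le_iSup_of_le n <| le_iSup_of_le m <| le_iSup_of_le α <| le_iSup_of_le hα <|
      le_iSup_of_le β <| le_iSup_of_le hβ <| ENNReal.ofReal_le_ofReal ?_
    rw [rd_mi_eq P _ _ hαX hβY]
    refine le_of_eq (congrArg (· / Real.log 2) (Finset.sum_congr rfl fun a _ => ?_))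
    rw [Finset.mul_sum]
    refine Finset.sum_congr rfl fun b _ => ?_
    rw [← mul_assoc, hWq, ← hpq]
    by_cases h0 : μ.real (α ⁻¹' {a}) = 0
    · have : P.real ((fun ω => α (Xv ω)) ⁻¹' {a} ∩ (fun ω => β (Yv ω)) ⁻¹' {b}) = 0 := by
        rw [← hWq, h0, zero_mul]
      rw [this]; simp
    · rw [← hWq, mul_div_mul_left _ _ h0]

lemma rd_trivial_code {d : ℕ} {T : (Fin d → ℝ) → X → X} (hT : IsContAction d T)
    (μ : Measure X) [IsProbabilityMeasure μ] (L δ : ℝ) (hL : 0 < L) (hδ : 0 < δ) :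
    ∃ C : RDCode d T L, C.dis μ ≤ δ := by
  classical
  have : Nonempty X := nonempty_of_isProbabilityMeasure μ
  obtain ⟨n, α, z, hα, hz⟩ := rd_partition hT L δ hδ
  have hn : (n : ℝ) ≠ 0 := by
    have : n ≠ 0 := by
      rintro rfl
      exact (α (Classical.arbitrary X)).elim0
    exact_mod_cast this
  refine ⟨⟨Fin n, Fin n, inferInstance, inferInstance, α, fun a b => if a = b then 1 else 0,
    fun _ => 1 / n, fun b => rdOrb hT L (z b),
    fun a b => if a = b then δ else Metric.diam (univ : Set X) * L ^ d,
    fun i => hα (measurableSet_singleton i), ?_, ?_, ?_, ?_, ?_, ?_⟩, ?_⟩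
  · intro a b; split_ifs <;> norm_num
  · intro a; simp
  · intro b; positivity
  · simp [hn]
  · intro a b h; simp [hn] at h
  · intro x b
    split_ifs with h
    · rw [← h]; exact hz x
    · exact rd_D_le hL.le _ _
  · have : ∀ x, (∑ b, (if α x = b then (1 : ℝ) else 0) *
        (if α x = b then δ else Metric.diam (univ : Set X) * L ^ d)) = δ := by
      intro x
      rw [Finset.sum_eq_single (α x)]
      · simp
      · intro b _ hb; simp [hb.symm]
      · simp
    simp only [RDCode.dis, this]
    simp

lemma rd_mix_code {d : ℕ} {T : (Fin d → ℝ) → X → X} 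
    (μ₀ μ₁ : Measure X) [IsProbabilityMeasure μ₀] [IsProbabilityMeasure μ₁] (L : ℝ)
    (p₀ p₁ : ℝ) (hp₀ : 0 ≤ p₀) (hp₁ : 0 ≤ p₁) (hp : p₀ + p₁ = 1)
    (C₀ C₁ : RDCode d T L) :
    ∃ C : RDCode d T L,
      C.dis (ENNReal.ofReal p₀ • μ₀ + ENNReal.ofReal p₁ • μ₁) = p₀ * C₀.dis μ₀ + p₁ * C₁.dis μ₁ ∧
      C.cost (ENNReal.ofReal p₀ • μ₀ + ENNReal.ofReal p₁ • μ₁)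
        ≤ p₀ * C₀.cost μ₀ + p₁ * C₁.cost μ₁ + Real.log 2 := by
  classical
  obtain ⟨A₀, B₀, fA₀, fB₀, α₀, W₀, ρ₀, y₀, c₀, hα₀, hW₀, hW1₀, hρ₀, hρ1₀, hac₀, hc₀⟩ := C₀
  obtain ⟨A₁, B₁, fA₁, fB₁, α₁, W₁, ρ₁, y₁, c₁, hα₁, hW₁, hW1₁, hρ₁, hρ1₁, hac₁, hc₁⟩ := C₁
  set μ := ENNReal.ofReal p₀ • μ₀ + ENNReal.ofReal p₁ • μ₁ with hμ
  let α : X → A₀ × A₁ := fun x => (α₀ x, α₁ x)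
  have hα : ∀ a, MeasurableSet (α ⁻¹' {a}) := by
    rintro ⟨a, b⟩
    have : α ⁻¹' {(a, b)} = α₀ ⁻¹' {a} ∩ α₁ ⁻¹' {b} := by ext x; simp [α]
    rw [this]; exact (hα₀ a).inter (hα₁ b)
  have hf₀ : IsFiniteMeasure (ENNReal.ofReal p₀ • μ₀) := μ₀.smul_finite ENNReal.ofReal_ne_top
  have hf₁ : IsFiniteMeasure (ENNReal.ofReal p₁ • μ₁) := μ₁.smul_finite ENNReal.ofReal_ne_top
  have hμr : ∀ a, μ.real (α ⁻¹' {a}) = p₀ * μ₀.real (α ⁻¹' {a}) + p₁ * μ₁.real (α ⁻¹' {a}) := by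
    intro a
    rw [hμ, measureReal_add_apply, measureReal_ennreal_smul_apply, measureReal_ennreal_smul_apply,
      ENNReal.toReal_ofReal hp₀, ENNReal.toReal_ofReal hp₁]
  have hμf : IsFiniteMeasure μ := by
    rw [hμ]; infer_instance
  let q : A₀ × A₁ → B₀ ⊕ B₁ → ℝ := fun a => Sum.elim
    (fun b => p₀ * μ₀.real (α ⁻¹' {a}) * W₀ a.1 b) (fun b => p₁ * μ₁.real (α ⁻¹' {a}) * W₁ a.2 b)
  let ρ : B₀ ⊕ B₁ → ℝ := Sum.elim (fun b => ρ₀ b / 2) (fun b => ρ₁ b / 2)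
  let c : A₀ × A₁ → B₀ ⊕ B₁ → ℝ := fun a => Sum.elim (fun b => c₀ a.1 b) (fun b => c₁ a.2 b)
  have n₀ : ∀ a, 0 ≤ p₀ * μ₀.real (α ⁻¹' {a}) := fun a => mul_nonneg hp₀ measureReal_nonneg
  have n₁ : ∀ a, 0 ≤ p₁ * μ₁.real (α ⁻¹' {a}) := fun a => mul_nonneg hp₁ measureReal_nonneg
  have hρ : ∀ b, 0 ≤ ρ b := by
    rintro (b | b)
    · exact div_nonneg (hρ₀ b) (by norm_num)
    · exact div_nonneg (hρ₁ b) (by norm_num)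
  have hρ1 : ∑ b, ρ b = 1 := by
    simp only [ρ, Fintype.sum_sum_type, Sum.elim_inl, Sum.elim_inr, ← Finset.sum_div, hρ1₀, hρ1₁]
    norm_num
  obtain ⟨W, hW, hW1, hac, hWq⟩ := rd_disint (fun a => μ.real (α ⁻¹' {a})) q
    (by
      rintro a (b | b)
      · exact mul_nonneg (n₀ a) (hW₀ _ _)
      · exact mul_nonneg (n₁ a) (hW₁ _ _))
    (by
      intro a
      simp only [q, Fintype.sum_sum_type, Sum.elim_inl, Sum.elim_inr, ← Finset.mul_sum, hW1₀, hW1₁]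
      rw [hμr]; ring)
    ρ hρ hρ1
    (by
      rintro a (b | b) h
      · have : ρ₀ b = 0 := by simpa [ρ] using h
        simp [q, hac₀ _ _ this]
      · have : ρ₁ b = 0 := by simpa [ρ] using h
        simp [q, hac₁ _ _ this])
  refine ⟨⟨A₀ × A₁, B₀ ⊕ B₁, inferInstance, inferInstance, α, W, ρ, Sum.elim y₀ y₁, c,
    hα, hW, hW1, hρ, hρ1, hac, ?_⟩, ?_, ?_⟩
  · rintro x (b | b)
    · exact hc₀ x b
    · exact hc₁ x b
  · simp only [RDCode.dis]
    rw [(rd_integral_fin μ α hα (fun a => ∑ b, W a b * c a b)).2,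
      (rd_integral_fin μ₀ α hα (fun a => ∑ b, W₀ a.1 b * c₀ a.1 b)).2,
      (rd_integral_fin μ₁ α hα (fun a => ∑ b, W₁ a.2 b * c₁ a.2 b)).2,
      Finset.mul_sum, Finset.mul_sum, ← Finset.sum_add_distrib]
    refine Finset.sum_congr rfl fun a _ => ?_
    rw [Finset.mul_sum]
    simp_rw [← mul_assoc, hWq]
    simp only [q, c, Fintype.sum_sum_type, Sum.elim_inl, Sum.elim_inr, mul_assoc, Finset.mul_sum]
  · simp only [RDCode.cost]
    rw [(rd_integral_fin μ α hα (fun a => ∑ b, W a b * Real.log (W a b / ρ b))).2,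
      (rd_integral_fin μ₀ α hα (fun a => ∑ b, W₀ a.1 b * Real.log (W₀ a.1 b / ρ₀ b))).2,
      (rd_integral_fin μ₁ α hα (fun a => ∑ b, W₁ a.2 b * Real.log (W₁ a.2 b / ρ₁ b))).2]
    have t₀ : ∑ a, μ₀.real (α ⁻¹' {a}) = 1 := by
      have := (rd_integral_fin μ₀ α hα (fun _ => 1)).2
      simpa using this.symm
    have t₁ : ∑ a, μ₁.real (α ⁻¹' {a}) = 1 := by
      have := (rd_integral_fin μ₁ α hα (fun _ => 1)).2
      simpa using this.symm
    have gen : ∀ l w w₀ r m : ℝ, 0 ≤ l → l ≤ m → 0 ≤ w₀ → 0 ≤ r → (r = 0 → w₀ = 0) →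
        m * w = l * w₀ → 0 ≤ w →
        l * w₀ * Real.log (w / (r / 2)) ≤ l * (w₀ * Real.log (w₀ / r)) + l * (w₀ * Real.log 2) := by
      intro l w w₀ r m hl hlm hw₀ hr hrw hmw hw
      rcases hl.eq_or_lt with h | hl
      · simp [← h]
      rcases hw₀.eq_or_lt with h | hw₀
      · simp [← h]
      have hr' : 0 < r := lt_of_le_of_ne hr fun h => hw₀.ne' (hrw h.symm)
      have hm : 0 < m := hl.trans_le hlm
      have hwpos : 0 < w := by
        rcases hw.eq_or_lt with h | h
        · rw [← h, mul_zero] at hmw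
          have := mul_pos hl hw₀; linarith
        · exact h
      have hww : w ≤ w₀ := by
        by_contra hcon
        push Not at hcon
        have : l * w₀ < m * w := by
          calc l * w₀ ≤ m * w₀ := by gcongr
            _ < m * w := by gcongr
        linarith
      have : Real.log (w / (r / 2)) ≤ Real.log (w₀ / r) + Real.log 2 := by
        rw [← Real.log_mul (by positivity) (by norm_num)]
        refine Real.log_le_log (by positivity) ?_
        rw [div_le_iff₀ (by positivity)]
        have : w₀ / r * 2 * (r / 2) = w₀ := by field_simp
        rw [this]; exact hww
      nlinarith [mul_le_mul_of_nonneg_left this (mul_pos hl hw₀).le]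
    have main : ∀ a, μ.real (α ⁻¹' {a}) * ∑ b, W a b * Real.log (W a b / ρ b)
        ≤ p₀ * (μ₀.real (α ⁻¹' {a}) * ∑ b, W₀ a.1 b * Real.log (W₀ a.1 b / ρ₀ b))
        + p₁ * (μ₁.real (α ⁻¹' {a}) * ∑ b, W₁ a.2 b * Real.log (W₁ a.2 b / ρ₁ b))
        + (p₀ * μ₀.real (α ⁻¹' {a}) + p₁ * μ₁.real (α ⁻¹' {a})) * Real.log 2 := by
      intro a
      have b₀ : ∑ b, p₀ * μ₀.real (α ⁻¹' {a}) * W₀ a.1 b * Real.log (W a (Sum.inl b) / (ρ₀ b / 2))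
          ≤ ∑ b, (p₀ * μ₀.real (α ⁻¹' {a}) * (W₀ a.1 b * Real.log (W₀ a.1 b / ρ₀ b))
            + p₀ * μ₀.real (α ⁻¹' {a}) * (W₀ a.1 b * Real.log 2)) :=
        Finset.sum_le_sum fun b _ => gen _ _ _ _ (μ.real (α ⁻¹' {a})) (n₀ a)
          (by rw [hμr]; linarith [n₁ a]) (hW₀ _ _) (hρ₀ _) (hac₀ _ _) (hWq a (Sum.inl b)) (hW _ _)
      have b₁ : ∑ b, p₁ * μ₁.real (α ⁻¹' {a}) * W₁ a.2 b * Real.log (W a (Sum.inr b) / (ρ₁ b / 2))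
          ≤ ∑ b, (p₁ * μ₁.real (α ⁻¹' {a}) * (W₁ a.2 b * Real.log (W₁ a.2 b / ρ₁ b))
            + p₁ * μ₁.real (α ⁻¹' {a}) * (W₁ a.2 b * Real.log 2)) :=
        Finset.sum_le_sum fun b _ => gen _ _ _ _ (μ.real (α ⁻¹' {a})) (n₁ a)
          (by rw [hμr]; linarith [n₀ a]) (hW₁ _ _) (hρ₁ _) (hac₁ _ _) (hWq a (Sum.inr b)) (hW _ _)
      rw [Finset.sum_add_distrib, ← Finset.mul_sum, ← Finset.mul_sum, ← Finset.sum_mul, hW1₀] at b₀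
      rw [Finset.sum_add_distrib, ← Finset.mul_sum, ← Finset.mul_sum, ← Finset.sum_mul, hW1₁] at b₁
      rw [Finset.mul_sum]
      simp_rw [← mul_assoc, hWq]
      simp only [q, ρ, Fintype.sum_sum_type, Sum.elim_inl, Sum.elim_inr]
      simp only [← mul_assoc] at b₀ b₁ ⊢
      linarith
    refine (Finset.sum_le_sum fun a _ => main a).trans (le_of_eq ?_)
    rw [Finset.sum_add_distrib, Finset.sum_add_distrib, ← Finset.sum_mul, Finset.sum_add_distrib,
      ← Finset.mul_sum, ← Finset.mul_sum, ← Finset.mul_sum, ← Finset.mul_sum, t₀, t₁]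
    rw [mul_one, mul_one, hp, one_mul]

end Discretize

section Concat

set_option linter.unusedSectionVars false

variable {X : Type*} [MetricSpace X] [CompactSpace X] [MeasurableSpace X] [BorelSpace X]

lemma rd_measurable_unitBox (d : ℕ) (L : ℝ) : MeasurableSet (unitBox d L) :=
  MeasurableSet.univ_pi fun _ => measurableSet_Ico

lemma rd_concat_map {d : ℕ} {T : (Fin d → ℝ) → X → X} (hT : IsContAction d T) [Nonempty X]
    (L₀ L : ℝ) (hL₀ : 0 < L₀) (k : ℕ) (hk : k * L₀ ≤ L) (b : (Fin d → Fin k) → L1Maps d L₀ X) :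
    ∃ y : L1Maps d L X, ∀ x, rdD d T L x y ≤
      ∑ κ : Fin d → Fin k, rdD d T L₀ (T (fun i => L₀ * (κ i : ℕ)) x) (b κ)
        + Metric.diam (univ : Set X) * (L ^ d - (k * L₀) ^ d) := by
  classical
  have hkL : 0 ≤ (k : ℝ) * L₀ := by positivity
  have hL : 0 ≤ L := hkL.trans hk
  let G : (Fin d → ℕ) → (Fin d → ℝ) → X := fun κ u =>
    if h : ∀ i, κ i < k then b (fun i => ⟨κ i, h i⟩) (u - fun i => L₀ * (κ i : ℝ))
    else Classical.arbitrary X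
  have hG : ∀ κ, Measurable (G κ) := by
    intro κ
    by_cases h : ∀ i, κ i < k
    · simp only [G, dif_pos h]
      exact (AEEqFun.stronglyMeasurable _).measurable.comp (measurable_id.sub_const _)
    · simp only [G, dif_neg h]
      exact measurable_const
  let f : (Fin d → ℝ) → X := fun u => G (fun i => ⌊u i / L₀⌋₊) u
  have hf : Measurable f := by
    have h1 : Measurable (Function.uncurry G) := measurable_from_prod_countable_right hG
    have h2 : Measurable fun u : Fin d → ℝ => ((fun i => ⌊u i / L₀⌋₊ : Fin d → ℕ), u) := by
      refine Measurable.prodMk ?_ measurable_id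
      refine measurable_pi_lambda _ fun i => ?_
      have h3 : Measurable fun u : Fin d → ℝ => u i / L₀ := by fun_prop
      exact Nat.measurable_floor.comp h3
    exact h1.comp h2
  refine ⟨AEEqFun.mk f hf.aestronglyMeasurable, fun x => ?_⟩
  let cube : (Fin d → Fin k) → Set (Fin d → ℝ) := fun κ =>
    Set.univ.pi fun i => Ico (L₀ * (κ i : ℕ)) (L₀ * ((κ i : ℕ) + 1))
  have hcm : ∀ κ, MeasurableSet (cube κ) := fun κ => MeasurableSet.univ_pi fun _ => measurableSet_Ico
  have hfl : ∀ κ, ∀ u ∈ cube κ, ∀ i, ⌊u i / L₀⌋₊ = (κ i : ℕ) := by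
    intro κ u hu i
    have := hu i (mem_univ i)
    rw [mem_Ico] at this
    rw [Nat.floor_eq_iff (div_nonneg (le_trans (by positivity) this.1) hL₀.le)]
    constructor
    · rw [le_div_iff₀ hL₀]; linarith [this.1]
    · rw [div_lt_iff₀ hL₀]; linarith [this.2]
  have hfc : ∀ κ, ∀ u ∈ cube κ, f u = b κ (u - fun i => L₀ * ((κ i : ℕ) : ℝ)) := by
    intro κ u hu
    have h1 : (fun i => ⌊u i / L₀⌋₊) = fun i => (κ i : ℕ) := funext (hfl κ u hu)
    have h2 : ∀ i, (κ i : ℕ) < k := fun i => (κ i).2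
    simp only [f]
    rw [h1]
    simp only [G, dif_pos h2]
  have hun : unitBox d (k * L₀) = ⋃ κ, cube κ := by
    ext u
    rw [mem_iUnion]
    constructor
    · intro hu
      have hu' : ∀ i, 0 ≤ u i ∧ u i < k * L₀ := fun i => hu i (mem_univ i)
      refine ⟨fun i => ⟨⌊u i / L₀⌋₊, ?_⟩, ?_⟩
      · rw [Nat.floor_lt (div_nonneg (hu' i).1 hL₀.le), div_lt_iff₀ hL₀]
        exact (hu' i).2
      · intro i _
        rw [mem_Ico]
        constructor
        · have := Nat.floor_le (div_nonneg (hu' i).1 hL₀.le)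
          rw [le_div_iff₀ hL₀] at this
          simpa [mul_comm] using this
        · have := Nat.lt_floor_add_one (u i / L₀)
          rw [div_lt_iff₀ hL₀] at this
          simpa [mul_comm] using this
    · rintro ⟨κ, hu⟩ i _
      have := hu i (mem_univ i)
      rw [mem_Ico] at this ⊢
      refine ⟨le_trans (by positivity) this.1, this.2.trans_le ?_⟩
      have : ((κ i : ℕ) : ℝ) + 1 ≤ k := by exact_mod_cast (κ i).2
      nlinarith
  have hdisj : Pairwise (Function.onFun Disjoint cube) := by
    intro κ κ' hne
    refine Set.disjoint_left.2 fun u hu hu' => hne ?_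
    funext i
    exact Fin.ext ((hfl κ u hu i).symm.trans (hfl κ' u hu' i))
  have hsub : unitBox d (k * L₀) ⊆ unitBox d L :=
    Set.pi_mono fun i _ => Ico_subset_Ico_right hk
  set g : (Fin d → ℝ) → ℝ := fun u => dist (T u x) (f u) with hg
  have hgi : IntegrableOn g (unitBox d L) volume := by
    have : Integrable g (boxMeasure d L) := rd_integrable _ _ _
      (rd_orb_cont hT x).aestronglyMeasurable hf.aestronglyMeasurable
    exact this
  have e0 : rdD d T L x (AEEqFun.mk f hf.aestronglyMeasurable) = ∫ u in unitBox d L, g u := by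
    unfold rdD
    refine integral_congr_ae ?_
    filter_upwards [AEEqFun.coeFn_mk (μ := boxMeasure d L) f hf.aestronglyMeasurable] with u hu
    rw [hu]
  have e1 : ∫ u in unitBox d L, g u
      = (∫ u in unitBox d (k * L₀), g u) + ∫ u in unitBox d L \ unitBox d (k * L₀), g u := by
    have := setIntegral_union (f := g) (μ := volume) (s := unitBox d (k * L₀)) (t := unitBox d L \ unitBox d (k * L₀))
      disjoint_sdiff_right ((rd_measurable_unitBox d L).diff (rd_measurable_unitBox d _))
      (hgi.mono_set hsub) (hgi.mono_set sdiff_subset)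
    rw [union_sdiff_cancel hsub] at this
    exact this
  have e2 : ∫ u in unitBox d L \ unitBox d (k * L₀), g u
      ≤ Metric.diam (univ : Set X) * (L ^ d - (k * L₀) ^ d) := by
    have hv : ∀ l : ℝ, volume (unitBox d l) = ENNReal.ofReal l ^ d := by
      intro l; rw [← rd_box_univ, boxMeasure, Measure.restrict_apply_univ]
    have hfin : volume (unitBox d L \ unitBox d (k * L₀)) < ⊤ :=
      (measure_mono sdiff_subset).trans_lt (by rw [hv]; exact ENNReal.pow_lt_top ENNReal.ofReal_lt_top)
    have hvr : volume.real (unitBox d L \ unitBox d (k * L₀)) = L ^ d - (k * L₀) ^ d := by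
      rw [measureReal_sdiff hsub (rd_measurable_unitBox d _)
          (by rw [hv]; exact ENNReal.pow_ne_top ENNReal.ofReal_ne_top), measureReal_def, measureReal_def, hv, hv,
        ENNReal.toReal_pow, ENNReal.toReal_pow, ENNReal.toReal_ofReal hL, ENNReal.toReal_ofReal hkL]
    have hfm : IsFiniteMeasure (volume.restrict (unitBox d L \ unitBox d (k * L₀))) :=
      ⟨by rw [Measure.restrict_apply_univ]; exact hfin⟩
    have := integral_mono_of_nonneg (μ := volume.restrict (unitBox d L \ unitBox d (k * L₀)))
      (f := g) (g := fun _ => Metric.diam (univ : Set X)) (Eventually.of_forall fun _ => dist_nonneg)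
      (integrable_const _) (Eventually.of_forall fun _ => rd_dist_le _ _)
    rw [integral_const, measureReal_restrict_apply_univ, hvr, smul_eq_mul] at this
    rw [mul_comm (Metric.diam _)]
    exact this
  have e3 : ∫ u in unitBox d (k * L₀), g u = ∑ κ, ∫ u in cube κ, g u := by
    rw [hun]
    refine integral_iUnion_fintype hcm hdisj fun κ => hgi.mono_set ?_
    exact (subset_iUnion cube κ).trans (hun ▸ hsub)
  have e4 : ∀ κ, ∫ u in cube κ, g u
      = rdD d T L₀ (T (fun i => L₀ * (κ i : ℕ)) x) (b κ) := by
    intro κ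
    set v : Fin d → ℝ := fun i => L₀ * ((κ i : ℕ) : ℝ) with hv
    have h1 : ∫ u in cube κ, g u = ∫ u in cube κ, dist (T u x) (b κ (u - v)) := by
      refine setIntegral_congr_fun (hcm κ) fun u hu => ?_
      simp only [hg]
      rw [hfc κ u hu]
    have hpre : (fun u => u + v) ⁻¹' (cube κ) = unitBox d L₀ := by
      ext u
      simp only [mem_preimage, cube, unitBox, mem_univ_pi, mem_Ico, Pi.add_apply, hv]
      refine forall_congr' fun i => ?_
      constructor
      · rintro ⟨h1, h2⟩; constructor <;> linarith
      · rintro ⟨h1, h2⟩; constructor <;> linarith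
    have h2 := (measurePreserving_add_right (volume : Measure (Fin d → ℝ)) v).setIntegral_preimage_emb
      (measurableEmbedding_addRight v) (fun u => dist (T u x) (b κ (u - v))) (cube κ)
    rw [h1, ← h2, hpre]
    unfold rdD boxMeasure
    simp only [add_sub_cancel_right, hT.2.2]
  rw [e0, e1, e3]
  simp_rw [e4]
  linarith

lemma rd_concat_code {d : ℕ} {T : (Fin d → ℝ) → X → X} (hT : IsContAction d T)
    (μ : Measure X) [IsProbabilityMeasure μ] (hμ : MeasInvariant d T μ)
    (L₀ L : ℝ) (hL₀ : 0 < L₀) (k : ℕ) (hk : k * L₀ ≤ L) (C : RDCode d T L₀) :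
    ∃ C' : RDCode d T L,
      C'.dis μ = k ^ d * C.dis μ + Metric.diam (univ : Set X) * (L ^ d - (k * L₀) ^ d) ∧
      C'.cost μ = k ^ d * C.cost μ := by
  classical
  have : Nonempty X := nonempty_of_isProbabilityMeasure μ
  obtain ⟨A, B, fA, fB, α, W, ρ, y, c, hα, hW, hW1, hρ, hρ1, hac, hc⟩ := C
  have hcat := fun b : (Fin d → Fin k) → B => rd_concat_map hT L₀ L hL₀ k hk (fun κ => y (b κ))
  choose y' hy' using hcat
  let v : (Fin d → Fin k) → (Fin d → ℝ) := fun κ i => L₀ * ((κ i : ℕ) : ℝ)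
  let α' : X → ((Fin d → Fin k) → A) := fun x κ => α (T (v κ) x)
  have hTm : ∀ κ, Measurable (T (v κ)) := fun κ => (rd_orb_cont' hT (v κ)).measurable
  have hαT : ∀ κ a, MeasurableSet ((fun x => α (T (v κ) x)) ⁻¹' {a}) := fun κ a => hTm κ (hα a)
  have hα' : ∀ a, MeasurableSet (α' ⁻¹' {a}) := by
    intro a
    have : α' ⁻¹' {a} = ⋂ κ, (fun x => α (T (v κ) x)) ⁻¹' {a κ} := by
      ext x
      rw [mem_preimage, mem_singleton_iff, funext_iff, mem_iInter]
      rfl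
    rw [this]
    exact MeasurableSet.iInter fun κ => hαT κ _
  have hinv : ∀ (g : A → ℝ), ∫ x, ∑ κ, g (α (T (v κ) x)) ∂μ = k ^ d * ∫ x, g (α x) ∂μ := by
    intro g
    rw [integral_finsetSum _ fun κ _ => (rd_integral_fin μ _ (hαT κ) g).1]
    have : ∀ κ, ∫ x, g (α (T (v κ) x)) ∂μ = ∫ x, g (α x) ∂μ := by
      intro κ
      conv_rhs => rw [← hμ (v κ)]
      rw [integral_map (hTm κ).aemeasurable]
      rw [hμ (v κ)]
      exact (rd_integral_fin μ α hα g).1.aestronglyMeasurable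
    simp_rw [this]
    simp
  set R := Metric.diam (univ : Set X) * (L ^ d - (k * L₀) ^ d) with hR
  have hone : ∀ w : (Fin d → Fin k) → B → ℝ, (∀ κ, ∑ b, w κ b = 1) →
      ∑ b : (Fin d → Fin k) → B, ∏ κ, w κ (b κ) = 1 := by
    intro w hw
    rw [← Fintype.prod_sum]
    simp [hw]
  refine ⟨⟨(Fin d → Fin k) → A, (Fin d → Fin k) → B, inferInstance, inferInstance, α',
    fun a b => ∏ κ, W (a κ) (b κ), fun b => ∏ κ, ρ (b κ), y',
    fun a b => ∑ κ, c (a κ) (b κ) + R, hα', ?_, ?_, ?_, ?_, ?_, ?_⟩, ?_, ?_⟩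
  · exact fun a b => Finset.prod_nonneg fun κ _ => hW _ _
  · exact fun a => hone (fun κ => W (a κ)) fun κ => hW1 _
  · exact fun b => Finset.prod_nonneg fun κ _ => hρ _
  · exact hone (fun _ => ρ) fun _ => hρ1
  · intro a b h
    obtain ⟨κ, hκ, h0⟩ := Finset.prod_eq_zero_iff.1 h
    exact Finset.prod_eq_zero hκ (hac _ _ h0)
  · intro x b
    refine (hy' b x).trans ?_
    have := Finset.sum_le_sum fun κ (_ : κ ∈ Finset.univ) => hc (T (v κ) x) (b κ)
    exact add_le_add_left this _
  · simp only [RDCode.dis]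
    have h1 : ∀ x, ∑ b : (Fin d → Fin k) → B, (∏ κ, W (α' x κ) (b κ)) * (∑ κ, c (α' x κ) (b κ) + R)
        = (∑ κ, (fun a => ∑ b, W a b * c a b) (α (T (v κ) x))) + R := by
      intro x
      simp_rw [mul_add, Finset.sum_add_distrib, ← Finset.sum_mul]
      rw [hone (fun κ => W (α' x κ)) fun κ => hW1 _, one_mul]
      congr 1
      simp_rw [Finset.mul_sum]
      rw [Finset.sum_comm]
      refine Finset.sum_congr rfl fun κ _ => ?_
      exact rd_sum_prod_marg (fun κ => W (α' x κ)) (fun κ => hW1 _) κ (fun b => c (α' x κ) b)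
    simp_rw [h1]
    rw [integral_add, hinv (fun a => ∑ b, W a b * c a b)]
    · simp
    · exact integrable_finsetSum _ fun κ _ =>
        (rd_integral_fin μ _ (hαT κ) (fun a => ∑ b, W a b * c a b)).1
    · exact integrable_const _
  · simp only [RDCode.cost]
    have h1 : ∀ x, ∑ b : (Fin d → Fin k) → B, (∏ κ, W (α' x κ) (b κ)) *
          Real.log ((∏ κ, W (α' x κ) (b κ)) / ∏ κ, ρ (b κ))
        = ∑ κ, (fun a => ∑ b, W a b * Real.log (W a b / ρ b)) (α (T (v κ) x)) := by
      intro x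
      exact rd_sum_prod_kl (fun κ => W (α' x κ)) (fun κ => hW1 _) ρ (fun κ b => hac _ b)
    simp_rw [h1]
    exact hinv (fun a => ∑ b, W a b * Real.log (W a b / ρ b))

lemma rd_eventually_code {d : ℕ} {T : (Fin d → ℝ) → X → X} (hT : IsContAction d T)
    (μ : Measure X) [IsProbabilityMeasure μ] (hμ : MeasInvariant d T μ)
    (L₀ ε K : ℝ) (hL₀ : 0 < L₀) (hK : 0 ≤ K) (C : RDCode d T L₀) (hC : C.dis μ < ε * L₀ ^ d)
    (hCK : C.cost μ ≤ K * L₀ ^ d) :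
    ∀ᶠ L : ℝ in atTop, ∃ C' : RDCode d T L, C'.dis μ < ε * L ^ d ∧ C'.cost μ ≤ K * L ^ d := by
  set M := Metric.diam (univ : Set X)
  have hLd : 0 < L₀ ^ d := pow_pos hL₀ d
  have t1 : Tendsto (fun L : ℝ => (⌊L₀⁻¹ * L⌋₊ : ℝ) / L) atTop (𝓝 L₀⁻¹) :=
    tendsto_nat_floor_mul_div_atTop (inv_nonneg.2 hL₀.le)
  have t2 : Tendsto (fun L : ℝ => ((⌊L₀⁻¹ * L⌋₊ : ℝ) / L) ^ d * C.dis μ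
      + M * (1 - ((⌊L₀⁻¹ * L⌋₊ : ℝ) / L * L₀) ^ d)) atTop
      (𝓝 (L₀⁻¹ ^ d * C.dis μ + M * (1 - (L₀⁻¹ * L₀) ^ d))) :=
    ((t1.pow d).mul_const _).add (((((t1.mul_const L₀)).pow d).const_sub 1).const_mul M)
  have hlim : L₀⁻¹ ^ d * C.dis μ + M * (1 - (L₀⁻¹ * L₀) ^ d) < ε := by
    rw [inv_mul_cancel₀ hL₀.ne', one_pow, sub_self, mul_zero, add_zero, inv_pow,
      inv_mul_lt_iff₀ hLd, mul_comm]
    exact hC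
  filter_upwards [t2.eventually (gt_mem_nhds hlim), eventually_gt_atTop 0] with L h1 hL
  set k := ⌊L₀⁻¹ * L⌋₊ with hk
  have hkL : (k : ℝ) * L₀ ≤ L := by
    have := Nat.floor_le (a := L₀⁻¹ * L) (by positivity)
    rw [inv_mul_eq_div, le_div_iff₀ hL₀] at this
    rw [hk, inv_mul_eq_div]
    exact this
  obtain ⟨C', hd', hc'⟩ := rd_concat_code hT μ hμ L₀ L hL₀ k hkL C
  refine ⟨C', ?_, ?_⟩
  · rw [hd']
    have hLp : 0 < L ^ d := pow_pos hL d
    have := mul_lt_mul_of_pos_right h1 hLp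
    refine lt_of_eq_of_lt ?_ this
    simp only [div_pow, mul_pow]
    field_simp
    ring
  · rw [hc']
    calc (k : ℝ) ^ d * C.cost μ ≤ k ^ d * (K * L₀ ^ d) := by gcongr
      _ = K * (k * L₀) ^ d := by rw [mul_pow]; ring
      _ ≤ K * L ^ d := by gcongr

end Concat

section Final

variable {X : Type*} [MetricSpace X] [CompactSpace X] [MeasurableSpace X] [BorelSpace X]

lemma rd_RD_le {d : ℕ} {T : (Fin d → ℝ) → X → X} (μ : Measure X) [IsProbabilityMeasure μ]
    (L ε K : ℝ) (hL : 0 < L) (C : RDCode d T L) (h : C.dis μ < ε * L ^ d)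
    (hK : C.cost μ ≤ K * Real.log 2 * L ^ d) : RD d T μ ε ≤ ENNReal.ofReal K := by
  have hLd : 0 < L ^ d := pow_pos hL d
  have hlog : 0 < Real.log 2 := Real.log_pos (by norm_num)
  have h1 := rd_code_le d T μ L ε hL C h
  have h2 : RD d T μ ε ≤ RL d T μ L ε / ENNReal.ofReal (L ^ d) := iInf₂_le L hL
  refine h2.trans ?_
  rw [ENNReal.div_le_iff (by simpa using hLd) ENNReal.ofReal_ne_top,
    ← ENNReal.ofReal_mul' hLd.le]
  refine h1.trans (ENNReal.ofReal_le_ofReal ?_)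
  rw [div_le_iff₀ hlog]
  linarith

lemma rd_RD_ne_top {d : ℕ} {T : (Fin d → ℝ) → X → X} (hT : IsContAction d T)
    (μ : Measure X) [IsProbabilityMeasure μ] (ε : ℝ) (hε : 0 < ε) : RD d T μ ε ≠ ⊤ := by
  obtain ⟨C, hC⟩ := rd_trivial_code hT μ 1 (ε / 2) one_pos (half_pos hε)
  have hlog : 0 < Real.log 2 := Real.log_pos (by norm_num)
  refine ne_top_of_le_ne_top ENNReal.ofReal_ne_top
    (rd_RD_le μ 1 ε (C.cost μ / Real.log 2) one_pos C ?_ ?_)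
  · rw [one_pow, mul_one]; linarith
  · rw [one_pow, mul_one, div_mul_cancel₀ _ hlog.ne']

lemma rd_near_code {d : ℕ} {T : (Fin d → ℝ) → X → X} (hT : IsContAction d T)
    (μ : Measure X) [IsProbabilityMeasure μ] (hμ : MeasInvariant d T μ) (ε η : ℝ) (hε : 0 < ε)
    (hη : 0 < η) :
    ∀ᶠ L : ℝ in atTop, ∃ C : RDCode d T L, C.dis μ < ε * L ^ d ∧
      C.cost μ ≤ (((RD d T μ ε).toReal + η) * Real.log 2) * L ^ d := by
  have hlog : 0 < Real.log 2 := Real.log_pos (by norm_num)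
  set r := (RD d T μ ε).toReal with hr
  have hr0 : 0 ≤ r := ENNReal.toReal_nonneg
  have hlt : RD d T μ ε < ENNReal.ofReal (r + η) := by
    rw [← ENNReal.ofReal_toReal (rd_RD_ne_top hT μ ε hε)]
    exact (ENNReal.ofReal_lt_ofReal_iff (by linarith)).2 (by linarith)
  unfold RD at hlt
  obtain ⟨L₀, hlt⟩ := iInf_lt_iff.1 hlt
  obtain ⟨hL₀, hlt⟩ := iInf_lt_iff.1 hlt
  have hLd : 0 < L₀ ^ d := pow_pos hL₀ d
  rw [ENNReal.div_lt_iff (Or.inl (by simpa using hLd)) (Or.inl ENNReal.ofReal_ne_top),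
    ← ENNReal.ofReal_mul' hLd.le] at hlt
  obtain ⟨C, h1, h2⟩ := rd_exists_code hT μ L₀ ε hL₀ _ hlt
  refine rd_eventually_code hT μ hμ L₀ ε _ hL₀ (by positivity) C h1 ?_
  rw [ENNReal.ofReal_lt_ofReal_iff (by positivity), div_lt_iff₀ hlog] at h2
  linarith

lemma rd_convex_pos {d : ℕ} (hd : 0 < d) {T : (Fin d → ℝ) → X → X} (hT : IsContAction d T)
    (p₀ p₁ : ℝ) (hp₀ : 0 ≤ p₀) (hp₁ : 0 ≤ p₁) (hp : p₀ + p₁ = 1)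
    (hq₀ : 0 < p₀) (hq₁ : 0 < p₁)
    (μ₀ μ₁ : Measure X) [IsProbabilityMeasure μ₀] [IsProbabilityMeasure μ₁]
    (h₀ : MeasInvariant d T μ₀) (h₁ : MeasInvariant d T μ₁)
    (ε₀ ε₁ : ℝ) (hε₀ : 0 < ε₀) (hε₁ : 0 < ε₁) :
    RD d T (ENNReal.ofReal p₀ • μ₀ + ENNReal.ofReal p₁ • μ₁) (p₀ * ε₀ + p₁ * ε₁)
      ≤ ENNReal.ofReal p₀ * RD d T μ₀ ε₀ + ENNReal.ofReal p₁ * RD d T μ₁ ε₁ := by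
  have hlog : 0 < Real.log 2 := Real.log_pos (by norm_num)
  have hprob : IsProbabilityMeasure (ENNReal.ofReal p₀ • μ₀ + ENNReal.ofReal p₁ • μ₁) := by
    constructor
    simp only [Measure.add_apply, Measure.smul_apply, measure_univ, smul_eq_mul, mul_one]
    rw [← ENNReal.ofReal_add hp₀ hp₁, hp, ENNReal.ofReal_one]
  set m := ENNReal.ofReal p₀ • μ₀ + ENNReal.ofReal p₁ • μ₁ with hm
  have hr₀ : 0 ≤ (RD d T μ₀ ε₀).toReal := ENNReal.toReal_nonneg
  have hr₁ : 0 ≤ (RD d T μ₁ ε₁).toReal := ENNReal.toReal_nonneg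
  have key := fun η hη => (rd_near_code hT μ₀ h₀ ε₀ η hε₀ hη)
  have key' := fun η hη => (rd_near_code hT μ₁ h₁ ε₁ η hε₁ hη)
  have q₀ := ENNReal.ofReal_toReal (rd_RD_ne_top hT μ₀ ε₀ hε₀)
  have q₁ := ENNReal.ofReal_toReal (rd_RD_ne_top hT μ₁ ε₁ hε₁)
  have hfin := rd_RD_ne_top hT m (p₀ * ε₀ + p₁ * ε₁) (by positivity)
  rw [← q₀, ← q₁]
  clear q₀ q₁
  generalize (RD d T μ₀ ε₀).toReal = r₀ at hr₀ key ⊢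
  generalize (RD d T μ₁ ε₁).toReal = r₁ at hr₁ key' ⊢
  have hpr : 0 ≤ p₀ * r₀ + p₁ * r₁ := add_nonneg (mul_nonneg hp₀ hr₀) (mul_nonneg hp₁ hr₁)
  rw [← ENNReal.ofReal_mul hp₀, ← ENNReal.ofReal_mul hp₁,
    ← ENNReal.ofReal_add (mul_nonneg hp₀ hr₀) (mul_nonneg hp₁ hr₁)]
  refine (ENNReal.le_ofReal_iff_toReal_le hfin hpr).2 ?_
  refine le_of_forall_pos_le_add fun η hη => ?_
  have hη2 : 0 < η / 2 := half_pos hη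
  have ev := (key _ hη2).and ((key' _ hη2).and
    ((eventually_ge_atTop (1 : ℝ)).and (eventually_ge_atTop (2 / η))))
  obtain ⟨L, ⟨C₀, a₀, b₀⟩, ⟨C₁, a₁, b₁⟩, hL1, hL2⟩ := ev.exists
  have hL : 0 < L := by linarith
  obtain ⟨C, e1, e2⟩ := rd_mix_code μ₀ μ₁ L p₀ p₁ hp₀ hp₁ hp C₀ C₁
  refine ENNReal.toReal_le_of_le_ofReal (by positivity) (rd_RD_le m L _ _ hL C ?_ ?_)
  · rw [e1]
    have := mul_lt_mul_of_pos_left a₀ hq₀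
    have := mul_lt_mul_of_pos_left a₁ hq₁
    linarith
  · refine e2.trans ?_
    have i0 := mul_le_mul_of_nonneg_left b₀ hp₀
    have i1 := mul_le_mul_of_nonneg_left b₁ hp₁
    have i2 : 1 ≤ η / 2 * L ^ d := by
      have h1 : L ≤ L ^ d := le_self_pow₀ hL1 hd.ne'
      have h2 : 1 ≤ η / 2 * L := by
        rw [div_le_iff₀ hη] at hL2
        linarith
      exact h2.trans (by gcongr)
    have i3 := mul_le_mul_of_nonneg_right i2 hlog.le
    have e : p₁ = 1 - p₀ := by linarith
    calc _ ≤ p₀ * ((r₀ + η / 2) * Real.log 2 * L ^ d) + p₁ * ((r₁ + η / 2) * Real.log 2 * L ^ d)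
          + η / 2 * L ^ d * Real.log 2 := by linarith
      _ = _ := by rw [e]; ring

lemma rd_convex {d : ℕ} (hd : 0 < d) {T : (Fin d → ℝ) → X → X} (hT : IsContAction d T)
    (p₀ p₁ : ℝ) (hp₀ : 0 ≤ p₀) (hp₁ : 0 ≤ p₁) (hp : p₀ + p₁ = 1)
    (μ₀ μ₁ : Measure X) [IsProbabilityMeasure μ₀] [IsProbabilityMeasure μ₁]
    (h₀ : MeasInvariant d T μ₀) (h₁ : MeasInvariant d T μ₁)
    (ε₀ ε₁ : ℝ) (hε₀ : 0 < ε₀) (hε₁ : 0 < ε₁) :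
    RD d T (ENNReal.ofReal p₀ • μ₀ + ENNReal.ofReal p₁ • μ₁) (p₀ * ε₀ + p₁ * ε₁)
      ≤ ENNReal.ofReal p₀ * RD d T μ₀ ε₀ + ENNReal.ofReal p₁ * RD d T μ₁ ε₁ := by
  rcases hp₀.eq_or_lt with h | hq₀
  · have : p₁ = 1 := by linarith
    subst h this
    simp
  rcases hp₁.eq_or_lt with h | hq₁
  · have : p₀ = 1 := by linarith
    subst h this
    simp
  exact rd_convex_pos hd hT p₀ p₁ hp₀ hp₁ hp hq₀ hq₁ μ₀ μ₁ h₀ h₁ ε₀ ε₁ hε₀ hε₁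

lemma rd_continuousOn {d : ℕ} (hd : 0 < d) {T : (Fin d → ℝ) → X → X} (hT : IsContAction d T)
    (μ : Measure X) [IsProbabilityMeasure μ] (hμ : MeasInvariant d T μ) :
    ContinuousOn (fun ε : ℝ => RD d T μ ε) (Set.Ioi 0) := by
  have hconv : ConvexOn ℝ (Set.Ioi (0 : ℝ)) fun ε => (RD d T μ ε).toReal := by
    refine ⟨convex_Ioi 0, fun x hx y hy a b ha hb hab => ?_⟩
    have h := rd_convex hd hT a b ha hb hab μ μ hμ hμ x y hx hy
    rw [← add_smul, ← ENNReal.ofReal_add ha hb, hab, ENNReal.ofReal_one, one_smul] at h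
    have fx := rd_RD_ne_top hT μ x hx
    have fy := rd_RD_ne_top hT μ y hy
    have n1 := ENNReal.mul_ne_top (ENNReal.ofReal_ne_top (r := a)) fx
    have n2 := ENNReal.mul_ne_top (ENNReal.ofReal_ne_top (r := b)) fy
    have := ENNReal.toReal_mono (ENNReal.add_ne_top.2 ⟨n1, n2⟩) h
    rw [ENNReal.toReal_add n1 n2, ENNReal.toReal_mul, ENNReal.toReal_mul,
      ENNReal.toReal_ofReal ha, ENNReal.toReal_ofReal hb] at this
    simpa only [smul_eq_mul] using this
  have hc := hconv.continuousOn isOpen_Ioi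
  refine (ENNReal.continuous_ofReal.comp_continuousOn hc).congr fun x hx => ?_
  exact (ENNReal.ofReal_toReal (rd_RD_ne_top hT μ x hx)).symm

end Final

/-- Lemma 3.5: convexity of the rate distortion function under convex combination of two
measures and distortion levels; in particular `ε ↦ R(𝐝, μ, ε)` is continuous on `(0,∞)`. -/
theorem RD_convex_two_measures
    {X : Type*} [MetricSpace X] [CompactSpace X] [MeasurableSpace X] [BorelSpace X]
    (d : ℕ) (hd : 0 < d) (T : (Fin d → ℝ) → X → X) (hT : IsContAction d T)
    (p₀ p₁ : ℝ) (hp₀ : 0 ≤ p₀) (hp₁ : 0 ≤ p₁) (hp : p₀ + p₁ = 1)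
    (μ₀ μ₁ : Measure X) [IsProbabilityMeasure μ₀] [IsProbabilityMeasure μ₁]
    (h₀ : MeasInvariant d T μ₀) (h₁ : MeasInvariant d T μ₁)
    (ε₀ ε₁ : ℝ) (hε₀ : 0 < ε₀) (hε₁ : 0 < ε₁) :
    RD d T (ENNReal.ofReal p₀ • μ₀ + ENNReal.ofReal p₁ • μ₁) (p₀ * ε₀ + p₁ * ε₁)
      ≤ ENNReal.ofReal p₀ * RD d T μ₀ ε₀ + ENNReal.ofReal p₁ * RD d T μ₁ ε₁ ∧
    ∀ μ : Measure X, IsProbabilityMeasure μ → MeasInvariant d T μ →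
      ContinuousOn (fun ε : ℝ => RD d T μ ε) (Set.Ioi 0) := by
  exact ⟨rd_convex hd hT p₀ p₁ hp₀ hp₁ hp μ₀ μ₁ h₀ h₁ ε₀ ε₁ hε₀ hε₁,
    fun μ hμ hinv => rd_continuousOn hd hT μ hinv⟩
end
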